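/- arXiv:1708.02819 — 2 statements merged into one kernel-verified Lean document; each statement's English description precedes it below -/
import Mathlib

section
/- Let f be a transcendental entire function and ε > 0, and suppose that the set {z ∈ Δ : |z f'(z)/f(z)| < n(|z|)^{1/2+ε} or |f(z)| < (1+ε)|z|} has finite logarithmic area. Then logarea(Δ \ I(f)) < ∞; in particular, area I(f) > 0. If, in addition, the Fatou set F(f) has no multiply connected component, then logarea(Δ \ (I(f) ∩ J(f))) < ∞, and thus area(I(f) ∩ J(f)) > 0. -/
open MeasureTheory Filter Metric Set Topology ENNReal

/-- Logarithmic area of a subset of the plane. -/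
noncomputable def logArea (A : Set ℂ) : ℝ≥0∞ :=
  ∫⁻ z in A, ENNReal.ofReal ((‖z‖ ^ 2)⁻¹)

/-- The set Δ = {z : |z| ≥ 1}. -/
def Delta : Set ℂ := {z : ℂ | 1 ≤ ‖z‖}

/-- Chordal (spherical) distance on the Riemann sphere ℂ ∪ {∞}, with ∞ encoded as `none`. -/
noncomputable def chordalDist : Option ℂ → Option ℂ → ℝ
  | none, none => 0
  | none, some w => 2 / Real.sqrt (1 + ‖w‖ ^ 2)
  | some z, none => 2 / Real.sqrt (1 + ‖z‖ ^ 2)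
  | some z, some w =>
      2 * ‖z - w‖ / (Real.sqrt (1 + ‖z‖ ^ 2) * Real.sqrt (1 + ‖w‖ ^ 2))

/-- Locally uniform convergence on `U` of a sequence of ℂ-valued functions towards a
function with values in the Riemann sphere, with respect to the spherical metric. -/
def SphLocUnifConvOn (F : ℕ → ℂ → ℂ) (g : ℂ → Option ℂ) (U : Set ℂ) : Prop :=
  ∀ K : Set ℂ, K ⊆ U → IsCompact K → ∀ ε : ℝ, 0 < ε →
    ∀ᶠ n in atTop, ∀ z ∈ K, chordalDist (some (F n z)) (g z) < ε

/-- The Fatou set: points having a neighborhood on which every sequence of iterates has a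
subsequence converging locally uniformly with respect to the spherical metric. -/
def fatouSet (f : ℂ → ℂ) : Set ℂ :=
  {z | ∃ U ∈ 𝓝 z, ∀ φ : ℕ → ℕ, StrictMono φ →
    ∃ ψ : ℕ → ℕ, StrictMono ψ ∧ ∃ g : ℂ → Option ℂ,
      SphLocUnifConvOn (fun n => f^[φ (ψ n)]) g U}

/-- The Julia set. -/
def juliaSet (f : ℂ → ℂ) : Set ℂ := (fatouSet f)ᶜ

/-- The escaping set. -/
def escapingSet (f : ℂ → ℂ) : Set ℂ :=
  {z | Tendsto (fun n => ‖f^[n] z‖) atTop atTop}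

/-- The Fatou set has no multiply connected component. -/
def NoMultiplyConnectedFatouComponent (f : ℂ → ℂ) : Prop :=
  ∀ z ∈ fatouSet f, SimplyConnectedSpace (connectedComponentIn (fatouSet f) z)

/-- Maximum modulus M(r,f). -/
noncomputable def maxMod (f : ℂ → ℂ) (r : ℝ) : ℝ :=
  sSup ((fun z => ‖f z‖) '' {z : ℂ | ‖z‖ = r})

/-- The order ρ(f) of an entire function, as an extended real number. -/
noncomputable def entireOrder (f : ℂ → ℂ) : EReal :=
  limsup (fun r : ℝ => ((Real.log (Real.log (maxMod f r)) / Real.log r : ℝ) : EReal)) atTop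

/-- The fast escaping set A(f). -/
def fastEscapingSet (f : ℂ → ℂ) : Set ℂ :=
  {z | ∃ R : ℝ, 0 < R ∧ (∀ r : ℝ, R ≤ r → r < maxMod f r) ∧
    ∃ L : ℕ, ∀ n : ℕ, L < n → (maxMod f)^[n - L] R ≤ ‖f^[n] z‖}

/-- `f` is a transcendental entire function. -/
def TranscendentalEntire (f : ℂ → ℂ) : Prop :=
  Differentiable ℂ f ∧ ¬ ∃ p : Polynomial ℂ, ∀ z, f z = p.eval z

/-- Order of vanishing of `g` at `z` (the least `k` with nonzero `k`-th derivative). -/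
noncomputable def vanishingOrder (g : ℂ → ℂ) (z : ℂ) : ℕ :=
  sInf {k : ℕ | iteratedDeriv k g z ≠ 0}

/-- n(r,a): the number of solutions of f(z) = a with |z| ≤ r, counted with multiplicity. -/
noncomputable def nCount (f : ℂ → ℂ) (a : ℂ) (r : ℝ) : ℕ :=
  ∑ᶠ z ∈ {z : ℂ | ‖z‖ ≤ r ∧ f z = a}, vanishingOrder (fun w => f w - a) z

/-- n(r) = max over a of n(r,a). -/
noncomputable def nMax (f : ℂ → ℂ) (r : ℝ) : ℕ := ⨆ a : ℂ, nCount f a r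

/-- Critical values of `f`. -/
def criticalValues (f : ℂ → ℂ) : Set ℂ := {w | ∃ z, deriv f z = 0 ∧ f z = w}

/-- Finite asymptotic values of `f`. -/
def asymptoticValues (f : ℂ → ℂ) : Set ℂ :=
  {w | ∃ γ : ℝ → ℂ, Continuous γ ∧ Tendsto (fun t => ‖γ t‖) atTop atTop ∧
    Tendsto (fun t => f (γ t)) atTop (𝓝 w)}

/-- The Eremenko–Lyubich class B. -/
def ELClass (f : ℂ → ℂ) : Prop :=
  TranscendentalEntire f ∧ Bornology.IsBounded (criticalValues f ∪ asymptoticValues f)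

/-- Semihyperbolic polynomial. -/
def SemiHyperbolic (p : Polynomial ℂ) : Prop :=
  ∃ ε : ℝ, 0 < ε ∧ ∃ N : ℕ, ∀ z ∈ juliaSet (fun w => p.eval w), ∀ n : ℕ, 1 ≤ n →
    ∀ V : Set ℂ, (∃ u ∈ (fun w => p.eval w)^[n] ⁻¹' ball z ε,
        V = connectedComponentIn ((fun w => p.eval w)^[n] ⁻¹' ball z ε) u) →
      ∀ w ∈ ball z ε,
        (∑ᶠ u ∈ {u : ℂ | u ∈ V ∧ (fun v => p.eval v)^[n] u = w},
          vanishingOrder (fun ζ => (fun v => p.eval v)^[n] ζ - w) u) ≤ N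


/-- An entire function of polynomial growth along a sequence of circles is a polynomial. -/
lemma exists_polynomial_of_growth_on_circles {f : ℂ → ℂ} (hf : Differentiable ℂ f) {C : ℝ} {d : ℕ}
    (h : ∀ S : ℝ, ∃ s ≥ S, ∀ z, ‖z‖ = s → ‖f z‖ ≤ C * s ^ d) :
    ∃ p : Polynomial ℂ, ∀ z, f z = p.eval z := by
  have hder : ∀ n, d < n → iteratedDeriv n f 0 = 0 := by
    intro n hn
    have key : ∀ S : ℝ, 1 ≤ S → ‖iteratedDeriv n f 0‖ ≤ n.factorial * |C| / S := by
      intro S hS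
      obtain ⟨s, hs, hfs⟩ := h S
      have hs0 : 0 < s := by linarith
      refine (Complex.norm_iteratedDeriv_le_of_forall_mem_sphere_norm_le (C := |C| * s ^ d) n hs0
        hf.diffContOnCl fun z hz => (hfs z (by simpa using hz)).trans ?_).trans ?_
      · gcongr
        exact le_abs_self C
      · obtain ⟨k, rfl⟩ := Nat.exists_eq_add_of_lt hn
        have h1 : s ≤ s ^ (k + 1) := le_self_pow₀ (by linarith) (by omega)
        calc ((d + k + 1).factorial : ℝ) * (|C| * s ^ d) / s ^ (d + k + 1)
            = (d + k + 1).factorial * |C| / s ^ (k + 1) := by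
              field_simp
              ring
          _ ≤ (d + k + 1).factorial * |C| / S := by gcongr; linarith
    have hlim : Tendsto (fun S : ℝ => n.factorial * |C| / S) atTop (𝓝 0) :=
      tendsto_const_nhds.div_atTop tendsto_id
    have := ge_of_tendsto hlim ((eventually_ge_atTop 1).mono key)
    simpa using this
  refine ⟨∑ n ∈ Finset.range (d + 1),
    Polynomial.C ((n.factorial : ℂ)⁻¹ * iteratedDeriv n f 0) * Polynomial.X ^ n, fun z => ?_⟩
  rw [← Complex.taylorSeries_eq_of_entire' 0 z hf, tsum_eq_sum (s := Finset.range (d + 1))]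
  · simp [Polynomial.eval_finsetSum]
  · intro n hn
    rw [hder n (by simpa using hn)]
    simp

/-- A weak form of Bloch's theorem. -/
lemma exists_ball_subset_image {g : ℂ → ℂ} {c : ℂ} {r : ℝ} (hr : 0 < r)
    (hg : DifferentiableOn ℂ g (ball c r)) (hd : deriv g c ≠ 0) :
    ∃ b, ball b (r * ‖deriv g c‖ / 96) ⊆ g '' ball c r := by
  have hg' : DifferentiableOn ℂ (deriv g) (ball c r) := hg.deriv isOpen_ball
  have hsub : closedBall c (r / 2) ⊆ ball c r := closedBall_subset_ball (by linarith)
  obtain ⟨a, ha, hmax⟩ := (isCompact_closedBall c (r / 2)).exists_isMaxOn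
    ⟨c, mem_closedBall_self (by linarith)⟩
    (f := fun ζ => (r / 2 - ‖ζ - c‖) * ‖deriv g ζ‖)
    (ContinuousOn.mul (by fun_prop) ((hg'.continuousOn.mono hsub).norm))
  have hmax' : ∀ ζ ∈ closedBall c (r / 2),
    (r / 2 - ‖ζ - c‖) * ‖deriv g ζ‖ ≤ (r / 2 - ‖a - c‖) * ‖deriv g a‖ := fun ζ hζ => hmax hζ
  have h0 := hmax' c (mem_closedBall_self (by linarith))
  simp only [sub_self, norm_zero, sub_zero] at h0
  have hA : 0 < ‖deriv g c‖ := norm_pos_iff.mpr hd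
  have hac : ‖a - c‖ ≤ r / 2 := by simpa [dist_eq_norm] using ha
  set B := ‖deriv g a‖ with hB
  set ρ := (r / 2 - ‖a - c‖) / 2 with hρ
  have hprod : r / 2 * ‖deriv g c‖ ≤ 2 * ρ * B := by rw [hρ]; linarith
  have hρ0 : 0 ≤ ρ := by rw [hρ]; linarith
  have hpos : 0 < 2 * ρ * B := lt_of_lt_of_le (by positivity) hprod
  have hρ1 : 0 < ρ := by
    rcases hρ0.eq_or_lt with h | h
    · rw [← h] at hpos; simp at hpos
    · exact h
  have hB1 : 0 < B := by
    by_contra h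
    have : B = 0 := le_antisymm (not_lt.mp h) (norm_nonneg _)
    rw [this] at hpos; simp at hpos
  have hball : ball a ρ ⊆ closedBall c (r / 2) := by
    intro ζ hζ
    have h1 : dist ζ a < ρ := hζ
    have h2 : dist ζ c ≤ dist ζ a + dist a c := dist_triangle _ _ _
    rw [dist_eq_norm a c] at h2
    rw [mem_closedBall]; linarith
  have hderiv2 : ∀ ζ ∈ ball a ρ, ‖deriv g ζ‖ ≤ 2 * B := by
    intro ζ hζ
    have h1 : dist ζ a < ρ := hζ
    have h2 : dist ζ c ≤ dist ζ a + dist a c := dist_triangle _ _ _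
    rw [dist_eq_norm a c, dist_eq_norm ζ c] at h2
    have h3 := hmax' ζ (hball hζ)
    have h4 : ρ * ‖deriv g ζ‖ ≤ (r / 2 - ‖ζ - c‖) * ‖deriv g ζ‖ := by
      gcongr; linarith
    have h5 : ρ * ‖deriv g ζ‖ ≤ ρ * (2 * B) := by
      have : (r / 2 - ‖a - c‖) = 2 * ρ := by rw [hρ]; ring
      rw [this] at h3; linarith
    exact le_of_mul_le_mul_left h5 hρ1
  have hschwarz : ∀ ζ ∈ ball a ρ, ‖deriv g ζ - deriv g a‖ ≤ 3 * B / ρ * ‖ζ - a‖ := by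
    intro ζ hζ
    have := Complex.dist_le_div_mul_dist_of_mapsTo_ball (f := deriv g) (c := a) (R₁ := ρ)
      (R₂ := 3 * B) (hg'.mono (hball.trans hsub)) (fun w hw => by
        rw [mem_closedBall, dist_eq_norm]
        calc ‖deriv g w - deriv g a‖ ≤ ‖deriv g w‖ + ‖deriv g a‖ := norm_sub_le _ _
          _ ≤ 3 * B := by linarith [hderiv2 w hw]) hζ
    simpa [dist_eq_norm] using this
  have hcb : closedBall a (ρ / 6) ⊆ ball a ρ := closedBall_subset_ball (by linarith)
  have hdiffAt : ∀ ζ ∈ ball a ρ, DifferentiableAt ℂ g ζ := fun ζ hζ =>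
    hg.differentiableAt (isOpen_ball.mem_nhds (hsub (hball hζ)))
  have hlin : ∀ ζ ∈ closedBall a (ρ / 6),
      ‖(g ζ - deriv g a * ζ) - (g a - deriv g a * a)‖ ≤ B / 2 * ‖ζ - a‖ := by
    intro ζ hζ
    refine (convex_closedBall a (ρ / 6)).norm_image_sub_le_of_norm_hasDerivWithin_le
      (f := fun ζ => g ζ - deriv g a * ζ) (f' := fun ζ => deriv g ζ - deriv g a)
      (fun w hw => ?_) (fun w hw => ?_) (mem_closedBall_self (by linarith)) hζ
    · have := ((hdiffAt w (hcb hw)).hasDerivAt.fun_sub ((hasDerivAt_id w).const_mul (deriv g a)))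
      simpa using this.hasDerivWithinAt
    · have h1 := hschwarz w (hcb hw)
      have h2 : ‖w - a‖ ≤ ρ / 6 := by simpa [dist_eq_norm] using hw
      calc _ ≤ 3 * B / ρ * ‖w - a‖ := h1
        _ ≤ 3 * B / ρ * (ρ / 6) := by gcongr
        _ = B / 2 := by field_simp; norm_num
  have hlow : ∀ ζ ∈ closedBall a (ρ / 6), B / 2 * ‖ζ - a‖ ≤ ‖g ζ - g a‖ := by
    intro ζ hζ
    have h1 := hlin ζ hζ
    have h2 : deriv g a * (ζ - a) =
      (g ζ - g a) - ((g ζ - deriv g a * ζ) - (g a - deriv g a * a)) := by ring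
    have h3 : B * ‖ζ - a‖ ≤ ‖g ζ - g a‖ + B / 2 * ‖ζ - a‖ := by
      rw [hB, ← norm_mul, h2]
      exact (norm_sub_le _ _).trans (by linarith)
    linarith
  refine ⟨g a, ?_⟩
  have hcov := DiffContOnCl.ball_subset_image_closedBall (f := g) (z₀ := a) (r := ρ / 6)
    (ε := B * ρ / 12) (DifferentiableOn.diffContOnCl (by
      rw [closure_ball a (by positivity)]
      exact fun w hw => (hdiffAt w (hcb hw)).differentiableWithinAt)) (by positivity) (fun z hz => by
      have h1 := hlow z (sphere_subset_closedBall hz)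
      have h2 : ‖z - a‖ = ρ / 6 := by simpa [dist_eq_norm] using hz
      rw [h2] at h1; linarith) (by
      have : ∀ᶠ z in 𝓝[≠] a, g z ≠ g a := by
        filter_upwards [self_mem_nhdsWithin,
          nhdsWithin_le_nhds (closedBall_mem_nhds a (show 0 < ρ / 6 by positivity))] with z hz hz'
        have hza : 0 < ‖z - a‖ := norm_pos_iff.mpr (sub_ne_zero.mpr hz)
        have h1 := hlow z hz'
        intro h
        rw [h, sub_self, norm_zero] at h1
        have : 0 < B / 2 * ‖z - a‖ := by positivity
        linarith
      exact this.frequently.filter_mono nhdsWithin_le_nhds)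
  refine (ball_subset_ball ?_).trans (hcov.trans (image_mono (hcb.trans (hball.trans hsub))))
  linarith

/-- A holomorphic branch of the logarithm on a simply connected open set. -/
lemma exists_differentiableOn_log {U : Set ℂ} (hU : IsOpen U) (hs : IsSimplyConnected U) {g : ℂ → ℂ}
    (hg : DifferentiableOn ℂ g U) (h0 : ∀ z ∈ U, g z ≠ 0) :
    ∃ L : ℂ → ℂ, DifferentiableOn ℂ L U ∧ ∀ z ∈ U, Complex.exp (L z) = g z := by
  obtain ⟨L, hL, hLg⟩ := Complex.exists_continuousOn_eqOn_exp_comp hs hU hg.continuousOn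
    (by rintro ⟨z, hz, hz'⟩; exact h0 z hz hz')
  refine ⟨L, fun z hz => ?_, fun z hz => hLg hz⟩
  have hnhds := hU.mem_nhds hz
  exact (HasDerivAt.of_comp_left (hL.continuousAt hnhds) (Complex.hasDerivAt_exp (L z))
    (hg.differentiableAt hnhds).hasDerivAt (Complex.exp_ne_zero _)
    (hLg.eventuallyEq_of_mem hnhds)).differentiableAt.differentiableWithinAt

lemma isSimplyConnected_ball (c : ℂ) {r : ℝ} (hr : 0 < r) : IsSimplyConnected (ball c r) := by
  have : ContractibleSpace (ball c r) :=
    (convex_ball c r).contractibleSpace ⟨c, mem_ball_self hr⟩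
  exact SimplyConnectedSpace.ofContractible _

/-- A Harnack inequality for holomorphic functions with positive real part. -/
lemma re_le_three_mul_re {H : ℂ → ℂ} {c : ℂ} {R : ℝ} (hH : DifferentiableOn ℂ H (ball c R))
    (hpos : ∀ z ∈ ball c R, 0 < (H z).re) {w : ℂ} (hw : w ∈ ball c (R / 2)) :
    (H w).re ≤ 3 * (H c).re := by
  have hw' : ‖w - c‖ < R / 2 := by simpa [dist_eq_norm] using hw
  have hR : 0 < R := by linarith [norm_nonneg (w - c)]
  have hmap : MapsTo (fun z => c + z) (ball 0 R) (ball c R) := fun z hz => by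
    simpa [dist_eq_norm] using hz
  have hc : 0 < (H c).re := hpos c (mem_ball_self hR)
  have := Complex.borelCaratheodory_zero (f := fun z => H c - H (c + z)) (z := w - c) (R := R) hc
    ((hH.comp (by fun_prop) hmap).const_sub _)
    (fun z hz => by
      have := hpos _ (hmap hz)
      simp only [Set.mem_ofPred_eq, Complex.sub_re]
      linarith) hR (by simpa using hw'.trans (by linarith)) (by simp)
  simp only [add_sub_cancel] at this
  have h2 : 2 * (H c).re * ‖w - c‖ / (R - ‖w - c‖) ≤ 2 * (H c).re := by
    rw [div_le_iff₀ (by linarith)]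
    gcongr
    linarith
  have h3 := (Complex.abs_re_le_norm (H c - H w)).trans (this.trans h2)
  rw [Complex.sub_re, abs_le] at h3
  linarith

/-- A Harnack inequality for `log |φ|`. -/
lemma log_norm_le_three_mul_log_norm {φ : ℂ → ℂ} {c : ℂ} {R : ℝ}
    (hφ : DifferentiableOn ℂ φ (ball c R)) (hgt : ∀ z ∈ ball c R, 1 < ‖φ z‖) {z w : ℂ}
    (hz : z ∈ ball c (R / 6)) (hw : w ∈ ball c (R / 6)) :
    Real.log ‖φ w‖ ≤ 3 * Real.log ‖φ z‖ := by
  have hR : 0 < R := by linarith [pos_of_mem_ball hz]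
  have hsub : ball z (R * (5 / 6)) ⊆ ball c R := ball_subset_ball' (by
    linarith [mem_ball.mp hz])
  obtain ⟨L, hL, hexp⟩ := exists_differentiableOn_log isOpen_ball (isSimplyConnected_ball c hR) hφ
    (fun ζ hζ h => by have := hgt ζ hζ; rw [h, norm_zero] at this; linarith)
  have hre : ∀ ζ ∈ ball c R, (L ζ).re = Real.log ‖φ ζ‖ := by
    intro ζ hζ
    rw [← hexp ζ hζ, Complex.norm_exp, Real.log_exp]
  have hwz : w ∈ ball z (R * (5 / 6) / 2) := by
    rw [mem_ball] at *
    linarith [dist_triangle_right w z c]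
  rw [← hre w (ball_subset_ball (by linarith) hw), ← hre z (ball_subset_ball (by linarith) hz)]
  exact re_le_three_mul_re (hL.mono hsub)
    (fun ζ hζ => by rw [hre ζ (hsub hζ)]; exact Real.log_pos (hgt ζ (hsub hζ))) hwz


lemma TranscendentalEntire.analyticOrderAt_sub_ne_top {f : ℂ → ℂ} (hf : TranscendentalEntire f)
    (a z : ℂ) : analyticOrderAt (fun w => f w - a) z ≠ ⊤ := by
  intro h
  have hd : Differentiable ℂ (fun w => f w - a) := hf.1.sub_const a
  rw [analyticOrderAt_eq_top] at h
  have han : AnalyticOnNhd ℂ (fun w => f w - a) univ := fun w _ => hd.analyticAt w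
  have := han.eqOn_zero_of_preconnected_of_eventuallyEq_zero isPreconnected_univ (mem_univ z) h
  refine hf.2 ⟨Polynomial.C a, fun w => ?_⟩
  have hw := this (mem_univ w)
  simpa [sub_eq_zero] using hw

lemma natCast_vanishingOrder {g : ℂ → ℂ} (hg : Differentiable ℂ g) {z : ℂ}
    (h : analyticOrderAt g z ≠ ⊤) : (vanishingOrder g z : ℕ∞) = analyticOrderAt g z := by
  have hne : {k : ℕ | iteratedDeriv k g z ≠ 0}.Nonempty := by
    by_contra hempty
    rw [Set.not_nonempty_iff_eq_empty] at hempty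
    refine h (ENat.eq_top_iff_forall_ge.mpr fun n => ?_)
    rw [natCast_le_analyticOrderAt_iff_iteratedDeriv_eq_zero (hg.analyticAt z)]
    intro i _
    by_contra hi
    have : i ∈ {k : ℕ | iteratedDeriv k g z ≠ 0} := hi
    simp [hempty] at this
  refine ((analyticOrderAt_eq_nat_iff_iteratedDeriv_eq_zero (hg.analyticAt z)).mpr
    ⟨fun k hk => ?_, Nat.sInf_mem hne⟩).symm
  by_contra hk'
  exact Nat.notMem_of_lt_sInf hk hk'

lemma exists_eq_pow_mul {g : ℂ → ℂ} (hg : Differentiable ℂ g) {z : ℂ} {n : ℕ}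
    (h : analyticOrderAt g z = n) :
    ∃ k : ℂ → ℂ, Differentiable ℂ k ∧ k z ≠ 0 ∧ ∀ w, g w = (w - z) ^ n * k w := by
  induction n generalizing g with
  | zero =>
    refine ⟨g, hg, ?_, fun w => by simp⟩
    exact ((hg.analyticAt z).analyticOrderAt_eq_zero).mp (by simpa using h)
  | succ n ih =>
    have hgz : g z = 0 := apply_eq_zero_of_analyticOrderAt_ne_zero (by rw [h]; simp)
    have hd : Differentiable ℂ (dslope g z) := by
      rw [← differentiableOn_univ, Complex.differentiableOn_dslope univ_mem]
      exact hg.differentiableOn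
    have hmul : g = (fun w => w - z) * dslope g z := by
      ext w
      simpa [hgz] using (sub_smul_dslope g z w).symm
    have hord : analyticOrderAt g z = 1 + analyticOrderAt (dslope g z) z := by
      conv_lhs => rw [hmul]
      rw [analyticOrderAt_mul (by fun_prop) (hd.analyticAt z)]
      congr 1
      exact analyticOrderAt_id_sub_const_self
    have : analyticOrderAt (dslope g z) z = n := by
      rw [h] at hord
      push_cast at hord
      rw [add_comm] at hord
      exact ((ENat.addLECancellable_of_ne_top ENat.one_ne_top).inj.mp hord).symm
    obtain ⟨k, hk, hkz, hkw⟩ := ih hd this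
    refine ⟨k, hk, hkz, fun w => ?_⟩
    have := congrFun hmul w
    rw [this, Pi.mul_apply, hkw w]
    ring

/-- Factoring out finitely many zeros, with multiplicity, of an entire function. -/
lemma exists_eq_prod_mul {g : ℂ → ℂ} (hg : Differentiable ℂ g) (S : Finset ℂ) (m : ℂ → ℕ)
    (h : ∀ z ∈ S, analyticOrderAt g z = m z) :
    ∃ k : ℂ → ℂ, Differentiable ℂ k ∧ (∀ z ∈ S, k z ≠ 0) ∧
      ∀ w, g w = (∏ z ∈ S, (w - z) ^ m z) * k w := by
  classical
  induction S using Finset.induction_on generalizing g with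
  | empty => exact ⟨g, hg, by simp, by simp⟩
  | insert z S hz ih =>
    obtain ⟨k₁, hk₁, hk₁z, hk₁w⟩ := exists_eq_pow_mul hg (h z (Finset.mem_insert_self z S))
    obtain ⟨k, hk, hkS, hkw⟩ := ih hk₁ (fun u hu => by
      have hmul : g = (fun w => (w - z) ^ m z) * k₁ := funext hk₁w
      rw [← h u (Finset.mem_insert_of_mem hu), hmul,
        analyticOrderAt_mul (by fun_prop) (hk₁.analyticAt u)]
      have huz : u - z ≠ 0 := sub_ne_zero.mpr (fun h => hz (h ▸ hu))
      have : analyticOrderAt (fun w => (w - z) ^ m z) u = 0 := by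
        rw [AnalyticAt.analyticOrderAt_eq_zero (by fun_prop)]
        exact pow_ne_zero _ huz
      rw [this, zero_add])
    refine ⟨k, hk, fun u hu => ?_, fun w => ?_⟩
    · rcases Finset.mem_insert.mp hu with rfl | hu
      · intro h0
        exact hk₁z (by rw [hkw, h0, mul_zero])
      · exact hkS u hu
    · rw [Finset.prod_insert hz, hk₁w, hkw, mul_assoc]

/-- A Jensen-type bound: many zeros in a disk force small values there. -/
lemma norm_le_mul_pow_of_zeros {g : ℂ → ℂ} (hg : Differentiable ℂ g) {r M : ℝ} (hr : 0 < r)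
    (hM : ∀ w, ‖w‖ = 4 * r → ‖g w‖ ≤ M) (S : Finset ℂ) (m : ℂ → ℕ) (hS : ∀ z ∈ S, ‖z‖ ≤ r)
    (h : ∀ z ∈ S, analyticOrderAt g z = m z) {p : ℂ} (hp : ‖p‖ ≤ r) :
    ‖g p‖ ≤ M * (2 / 3) ^ ∑ z ∈ S, m z := by
  obtain ⟨k, hk, -, hkw⟩ := exists_eq_prod_mul hg S m h
  set N := ∑ z ∈ S, m z with hN
  have hk_le : ∀ w, ‖w‖ = 4 * r → ‖k w‖ ≤ M / (3 * r) ^ N := by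
    intro w hw
    rw [le_div_iff₀ (by positivity)]
    have h1 : (3 * r) ^ N ≤ ‖∏ z ∈ S, (w - z) ^ m z‖ := by
      rw [norm_prod, hN, ← Finset.prod_pow_eq_pow_sum]
      refine Finset.prod_le_prod (fun _ _ => by positivity) fun z hz => ?_
      rw [norm_pow]
      have := norm_sub_norm_le w z
      have := hS z hz
      gcongr
      linarith
    calc ‖k w‖ * (3 * r) ^ N ≤ ‖k w‖ * ‖∏ z ∈ S, (w - z) ^ m z‖ := by gcongr
      _ = ‖g w‖ := by rw [hkw w, norm_mul, mul_comm]
      _ ≤ M := hM w hw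
  have hkp : ‖k p‖ ≤ M / (3 * r) ^ N := by
    refine Complex.norm_le_of_forall_mem_frontier_norm_le (U := ball 0 (4 * r)) isBounded_ball
      hk.diffContOnCl (fun w hw => hk_le w ?_) (subset_closure ?_)
    · rw [frontier_ball _ (by positivity)] at hw
      simpa using hw
    · rw [mem_ball_zero_iff]; linarith
  have h2 : ‖∏ z ∈ S, (p - z) ^ m z‖ ≤ (2 * r) ^ N := by
    rw [norm_prod, hN, ← Finset.prod_pow_eq_pow_sum]
    refine Finset.prod_le_prod (fun _ _ => by positivity) fun z hz => ?_
    rw [norm_pow]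
    have := norm_sub_le p z
    have := hS z hz
    gcongr
    linarith
  calc ‖g p‖ = ‖∏ z ∈ S, (p - z) ^ m z‖ * ‖k p‖ := by rw [hkw p, norm_mul]
    _ ≤ (2 * r) ^ N * (M / (3 * r) ^ N) := by gcongr
    _ = M * (2 / 3) ^ N := by
      rw [mul_pow, mul_pow, div_pow]
      field_simp

lemma TranscendentalEntire.exists_apply_ne {f : ℂ → ℂ} (hf : TranscendentalEntire f) :
    ∃ p q, f p ≠ f q := by
  by_contra! h
  exact hf.2 ⟨Polynomial.C (f 0), fun z => by simpa using h z 0⟩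

lemma TranscendentalEntire.exists_sum_vanishingOrder_le {f : ℂ → ℂ} (hf : TranscendentalEntire f)
    (r : ℝ) : ∃ N : ℕ, ∀ a, ∀ S : Finset ℂ, (∀ z ∈ S, ‖z‖ ≤ r ∧ f z = a) →
      ∑ z ∈ S, vanishingOrder (fun w => f w - a) z ≤ N := by
  obtain ⟨p, q, hpq⟩ := hf.exists_apply_ne
  set s := max (max r 1) (max ‖p‖ ‖q‖) with hs
  have hs1 : 0 < s := lt_of_lt_of_le one_pos ((le_max_right r 1).trans (le_max_left _ _))
  have hrs : r ≤ s := (le_max_left r 1).trans (le_max_left _ _)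
  have hps : ‖p‖ ≤ s := (le_max_left ‖p‖ ‖q‖).trans (le_max_right _ _)
  have hqs : ‖q‖ ≤ s := (le_max_right ‖p‖ ‖q‖).trans (le_max_right _ _)
  obtain ⟨M, hM⟩ := (isCompact_closedBall (0 : ℂ) (4 * s)).exists_bound_of_continuousOn
    hf.1.continuous.continuousOn
  have hM' : ∀ w, ‖w‖ ≤ 4 * s → ‖f w‖ ≤ M := fun w hw => hM w (by simpa using hw)
  have hδ : 0 < ‖f p - f q‖ / 2 := by
    have : 0 < ‖f p - f q‖ := norm_pos_iff.mpr (sub_ne_zero.mpr hpq)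
    positivity
  have hM0 : 0 ≤ M := (norm_nonneg _).trans (hM' p (by linarith))
  have hlim : Tendsto (fun n : ℕ => 2 * M * (2 / 3 : ℝ) ^ n) atTop (𝓝 0) := by
    simpa using (tendsto_pow_atTop_nhds_zero_of_lt_one (by norm_num : (0 : ℝ) ≤ 2 / 3)
      (by norm_num)).const_mul (2 * M)
  obtain ⟨N, hN⟩ := (hlim.eventually_lt_const hδ).exists
  refine ⟨N, fun a S hS => ?_⟩
  rcases S.eq_empty_or_nonempty with rfl | ⟨z₀, hz₀⟩
  · simp
  have ha : ‖a‖ ≤ M := by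
    rw [← (hS z₀ hz₀).2]
    exact hM' _ (by linarith [(hS z₀ hz₀).1])
  have hkey : ∀ u, ‖u‖ ≤ s → ‖f u - a‖ ≤
      2 * M * (2 / 3) ^ ∑ z ∈ S, vanishingOrder (fun w => f w - a) z := by
    intro u hu
    refine norm_le_mul_pow_of_zeros (g := fun w => f w - a) (hf.1.sub_const a) hs1
      (fun w hw => ?_) S _ (fun z hz => (hS z hz).1.trans hrs) (fun z _ => ?_) hu
    · exact (norm_sub_le _ _).trans (by linarith [hM' w hw.le])
    · exact (natCast_vanishingOrder (hf.1.sub_const a) (hf.analyticOrderAt_sub_ne_top a z)).symm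
  by_contra! hlt
  have hle : 2 * M * (2 / 3 : ℝ) ^ ∑ z ∈ S, vanishingOrder (fun w => f w - a) z
      ≤ 2 * M * (2 / 3) ^ N := by
    have := pow_le_pow_of_le_one (by norm_num : (0 : ℝ) ≤ 2 / 3) (by norm_num) hlt.le
    gcongr
  have h1 := hkey p hps
  have h2 := hkey q hqs
  have h3 : ‖f p - f q‖ ≤ ‖f p - a‖ + ‖f q - a‖ := by
    have := norm_sub_le (f p - a) (f q - a)
    rwa [sub_sub_sub_cancel_right] at this
  linarith

lemma TranscendentalEntire.one_le_vanishingOrder {f : ℂ → ℂ} (hf : TranscendentalEntire f)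
    (z : ℂ) : 1 ≤ vanishingOrder (fun w => f w - f z) z := by
  have h1 := natCast_vanishingOrder (hf.1.sub_const (f z)) (hf.analyticOrderAt_sub_ne_top (f z) z)
  have h2 : analyticOrderAt (fun w => f w - f z) z ≠ 0 := by
    rw [AnalyticAt.analyticOrderAt_ne_zero ((hf.1.sub_const (f z)).analyticAt z)]
    simp
  rw [← h1] at h2
  exact Nat.one_le_iff_ne_zero.mpr (by exact_mod_cast h2)

lemma TranscendentalEntire.card_le_sum_vanishingOrder {f : ℂ → ℂ} (hf : TranscendentalEntire f)
    {a : ℂ} {S : Finset ℂ} (hS : ∀ z ∈ S, f z = a) :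
    S.card ≤ ∑ z ∈ S, vanishingOrder (fun w => f w - a) z := by
  rw [Finset.card_eq_sum_ones]
  exact Finset.sum_le_sum fun z hz => by rw [← hS z hz]; exact hf.one_le_vanishingOrder z

lemma TranscendentalEntire.finite_fiber {f : ℂ → ℂ} (hf : TranscendentalEntire f) (a : ℂ) (r : ℝ) :
    {z : ℂ | ‖z‖ ≤ r ∧ f z = a}.Finite := by
  obtain ⟨N, hN⟩ := hf.exists_sum_vanishingOrder_le r
  by_contra hinf
  obtain ⟨S, hS, hcard⟩ := Set.Infinite.exists_subset_card_eq hinf (N + 1)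
  have h1 := hN a S (fun z hz => hS hz)
  have h2 := hf.card_le_sum_vanishingOrder (a := a) (S := S) (fun z hz => (hS hz).2)
  omega

lemma TranscendentalEntire.nCount_eq_sum {f : ℂ → ℂ} (hf : TranscendentalEntire f) (a : ℂ) (r : ℝ) :
    nCount f a r =
      ∑ z ∈ (hf.finite_fiber a r).toFinset, vanishingOrder (fun w => f w - a) z :=
  finsum_mem_eq_finite_toFinset_sum _ _

lemma TranscendentalEntire.nCount_le_nMax {f : ℂ → ℂ} (hf : TranscendentalEntire f) (a : ℂ)
    (r : ℝ) : nCount f a r ≤ nMax f r := by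
  obtain ⟨N, hN⟩ := hf.exists_sum_vanishingOrder_le r
  refine le_ciSup (f := fun a => nCount f a r) ⟨N, ?_⟩ a
  rintro _ ⟨b, rfl⟩
  simp only
  rw [hf.nCount_eq_sum]
  exact hN b _ (fun z hz => by simpa using hz)

lemma TranscendentalEntire.card_le_nMax {f : ℂ → ℂ} (hf : TranscendentalEntire f) {a : ℂ} {r : ℝ}
    {S : Finset ℂ} (hS : ∀ z ∈ S, ‖z‖ ≤ r ∧ f z = a) : S.card ≤ nMax f r := by
  refine (hf.card_le_sum_vanishingOrder fun z hz => (hS z hz).2).trans (le_trans ?_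
    (hf.nCount_le_nMax a r))
  rw [hf.nCount_eq_sum]
  exact Finset.sum_le_sum_of_subset fun z hz => by simpa using hS z hz

lemma TranscendentalEntire.nMax_mono {f : ℂ → ℂ} (hf : TranscendentalEntire f) :
    Monotone (nMax f) := by
  intro r s hrs
  refine ciSup_le' fun a => le_trans ?_ (hf.nCount_le_nMax a s)
  rw [hf.nCount_eq_sum, hf.nCount_eq_sum]
  refine Finset.sum_le_sum_of_subset fun z hz => ?_
  simp only [Set.Finite.mem_toFinset, Set.mem_ofPred_eq] at hz ⊢
  exact ⟨hz.1.trans hrs, hz.2⟩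

/-- The Casorati-Weierstrass theorem at infinity for transcendental entire functions. -/
lemma TranscendentalEntire.dense_image {f : ℂ → ℂ} (hf : TranscendentalEntire f) (R : ℝ) :
    Dense (f '' {z | R < ‖z‖}) := by
  intro a
  by_contra ha
  rw [Metric.mem_closure_iff] at ha
  push Not at ha
  obtain ⟨δ, hδ, hfar⟩ := ha
  have hfar' : ∀ z, R < ‖z‖ → δ ≤ ‖f z - a‖ := fun z hz => by
    rw [← dist_eq_norm, dist_comm]
    exact hfar _ (mem_image_of_mem f hz)
  have hd : Differentiable ℂ (fun w => f w - a) := hf.1.sub_const a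
  set S := (hf.finite_fiber a R).toFinset with hS
  set m := vanishingOrder (fun w => f w - a) with hm
  obtain ⟨k, hk, hkS, hkw⟩ := exists_eq_prod_mul hd S m
    fun z _ => (natCast_vanishingOrder hd (hf.analyticOrderAt_sub_ne_top a z)).symm
  have hk0 : ∀ z, k z ≠ 0 := by
    intro z hz
    have hfz : f z - a = 0 := by rw [hkw z, hz, mul_zero]
    refine hkS z ?_ hz
    rw [hS, Set.Finite.mem_toFinset]
    refine ⟨?_, sub_eq_zero.mp hfz⟩
    by_contra! hlt
    have := hfar' z hlt
    rw [hfz, norm_zero] at this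
    linarith
  obtain ⟨q, hq⟩ := exists_polynomial_of_growth_on_circles (f := fun z => (k z)⁻¹)
    (fun z => (hk z).inv (hk0 z)) (C := 2 ^ (∑ z ∈ S, m z) / δ) (d := ∑ z ∈ S, m z)
    (fun T => ⟨max T (|R| + 1), le_max_left _ _, fun w hw => by
      have hw1 : |R| + 1 ≤ ‖w‖ := hw ▸ le_max_right _ _
      have hw2 : R < ‖w‖ := by linarith [le_abs_self R]
      have h1 := hfar' w hw2
      have h2 : ‖∏ z ∈ S, (w - z) ^ m z‖ ≤ (2 * ‖w‖) ^ ∑ z ∈ S, m z := by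
        rw [norm_prod, ← Finset.prod_pow_eq_pow_sum]
        refine Finset.prod_le_prod (fun _ _ => by positivity) fun z hz => ?_
        rw [norm_pow]
        have h3 := norm_sub_le w z
        have h4 : ‖z‖ ≤ R := by
          rw [hS, Set.Finite.mem_toFinset] at hz
          exact hz.1
        gcongr
        linarith
      rw [hkw w, norm_mul] at h1
      have hkpos : 0 < ‖k w‖ := norm_pos_iff.mpr (hk0 w)
      rw [← hw, norm_inv, inv_le_iff_one_le_mul₀ hkpos, div_mul_eq_mul_div, div_mul_eq_mul_div,
        one_le_div hδ, ← mul_pow]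
      exact h1.trans (by gcongr)⟩)
  have hdeg : q.degree = 0 := by
    by_contra hne
    obtain ⟨z, hz⟩ := IsAlgClosed.exists_root q hne
    have := hq z
    rw [hz.eq_zero, inv_eq_zero] at this
    exact hk0 z this
  rw [Polynomial.eq_C_of_degree_eq_zero hdeg] at hq
  refine hf.2 ⟨(∏ z ∈ S, (Polynomial.X - Polynomial.C z) ^ m z) *
    Polynomial.C (q.coeff 0)⁻¹ + Polynomial.C a, fun w => ?_⟩
  have h1 := hq w
  simp only [Polynomial.eval_C] at h1
  have h2 := hkw w
  simp only [Polynomial.eval_add, Polynomial.eval_mul, Polynomial.eval_prod, Polynomial.eval_pow,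
    Polynomial.eval_sub, Polynomial.eval_X, Polynomial.eval_C, ← h1, inv_inv]
  rw [← h2]
  ring

lemma TranscendentalEntire.exists_frequently_eq {f : ℂ → ℂ} (hf : TranscendentalEntire f) :
    ∃ a, ∀ k : ℕ, ∃ z, (k : ℝ) < ‖z‖ ∧ f z = a := by
  have hopen : IsOpenMap f := by
    have han : AnalyticOnNhd ℂ f univ := fun w _ => hf.1.analyticAt w
    rcases han.is_constant_or_isOpenMap with ⟨w, hw⟩ | h
    · exact absurd ⟨Polynomial.C w, fun z => by simp [hw z]⟩ hf.2
    · exact h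
  have hdense : Dense (⋂ k : ℕ, f '' {z | (k : ℝ) < ‖z‖}) :=
    dense_iInter_of_isOpen (fun k => hopen _ (isOpen_lt continuous_const continuous_norm))
      fun k => hf.dense_image k
  obtain ⟨a, ha⟩ := hdense.nonempty
  refine ⟨a, fun k => ?_⟩
  obtain ⟨z, hz, hza⟩ := mem_iInter.mp ha k
  exact ⟨z, hz, hza⟩

lemma TranscendentalEntire.exists_le_nMax {f : ℂ → ℂ} (hf : TranscendentalEntire f) (N : ℕ) :
    ∃ r, N ≤ nMax f r := by
  obtain ⟨a, ha⟩ := hf.exists_frequently_eq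
  have hinf : {z | f z = a}.Infinite := by
    intro hfin
    obtain ⟨M, hM⟩ := (hfin.isBounded).exists_norm_le
    obtain ⟨k, hk⟩ := exists_nat_gt M
    obtain ⟨z, hz, hza⟩ := ha k
    exact absurd (hM z hza) (by linarith)
  obtain ⟨S, hS, rfl⟩ := hinf.exists_subset_card_eq N
  obtain ⟨M, hM⟩ := (S.finite_toSet.isBounded).exists_norm_le
  exact ⟨M, hf.card_le_nMax (a := a) fun z hz => ⟨hM z hz, hS hz⟩⟩


lemma logArea_eq_withDensity (A : Set ℂ) :
    logArea A = (volume : Measure ℂ).withDensity (fun z => ENNReal.ofReal ((‖z‖ ^ 2)⁻¹)) A :=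
  (withDensity_apply' _ A).symm

lemma logArea_mono {A B : Set ℂ} (h : A ⊆ B) : logArea A ≤ logArea B := lintegral_mono_set h

lemma logArea_union_le (A B : Set ℂ) : logArea (A ∪ B) ≤ logArea A + logArea B :=
  lintegral_union_le _ A B

lemma logArea_iUnion_le (A : ℕ → Set ℂ) : logArea (⋃ n, A n) ≤ ∑' n, logArea (A n) :=
  lintegral_iUnion_le A _

lemma exists_isOpen_injOn {f : ℂ → ℂ} (hf : Differentiable ℂ f) {z : ℂ} (h : deriv f z ≠ 0) :
    ∃ U, IsOpen U ∧ z ∈ U ∧ InjOn f U := by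
  have hs : HasStrictDerivAt f (deriv f z) z := (hf.analyticAt z).hasStrictDerivAt
  have hs' := hs.hasStrictFDerivAt_equiv h
  exact ⟨(hs'.toOpenPartialHomeomorph f).source, (hs'.toOpenPartialHomeomorph f).open_source,
    hs'.mem_toOpenPartialHomeomorph_source, by
      simpa using (hs'.toOpenPartialHomeomorph f).injOn⟩

lemma exists_seq_isOpen_injOn {f : ℂ → ℂ} (hf : Differentiable ℂ f) {S : Set ℂ}
    (h : ∀ z ∈ S, deriv f z ≠ 0) :
    ∃ U : ℕ → Set ℂ, (∀ n, IsOpen (U n)) ∧ (∀ n, InjOn f (U n)) ∧ S ⊆ ⋃ n, U n := by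
  have : ∀ z, ∃ U, IsOpen U ∧ InjOn f U ∧ (z ∈ S → z ∈ U) := by
    intro z
    by_cases hz : z ∈ S
    · obtain ⟨U, h1, h2, h3⟩ := exists_isOpen_injOn hf (h z hz)
      exact ⟨U, h1, h3, fun _ => h2⟩
    · exact ⟨∅, isOpen_empty, by simp, fun h => absurd h hz⟩
  choose U hUo hUi hUz using this
  obtain ⟨t, -, htc, ht⟩ := TopologicalSpace.countable_cover_nhdsWithin (s := S) (f := U)
    (fun z hz => mem_nhdsWithin_of_mem_nhds ((hUo z).mem_nhds (hUz z hz)))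
  rcases t.eq_empty_or_nonempty with rfl | hne
  · exact ⟨fun _ => ∅, by simp, by simp, by simpa using ht⟩
  obtain ⟨e, rfl⟩ := htc.exists_eq_range hne
  exact ⟨fun n => U (e n), fun n => hUo _, fun n => hUi _, by simpa using ht⟩

lemma abs_det_restrictScalars_smulRight (a : ℂ) :
    |((ContinuousLinearMap.toSpanSingleton ℂ a).restrictScalars ℝ).det| = ‖a‖ ^ 2 := by
  have : (((ContinuousLinearMap.toSpanSingleton ℂ a).restrictScalars ℝ : ℂ →L[ℝ] ℂ) : ℂ →ₗ[ℝ] ℂ)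
      = Algebra.lmul ℝ ℂ a := by
    ext; simp [mul_comm]
  rw [ContinuousLinearMap.det, this, ← Algebra.norm_apply, Algebra.norm_complex_apply,
    Complex.normSq_eq_norm_sq, abs_of_nonneg (by positivity)]

/-- Change of variables for an entire function whose fibres in `S` have at most `N` points. -/
lemma lintegral_norm_deriv_sq_mul_comp_le {f : ℂ → ℂ} (hf : Differentiable ℂ f) {S A : Set ℂ}
    (hS : MeasurableSet S) (h0 : ∀ z ∈ S, deriv f z ≠ 0) (hSA : MapsTo f S A) {N : ℕ}
    (hN : ∀ w, ∀ s : Finset ℂ, (∀ z ∈ s, z ∈ S ∧ f z = w) → s.card ≤ N)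
    {g : ℂ → ℝ≥0∞} (hg : Measurable g) (hA : MeasurableSet A) :
    ∫⁻ z in S, ENNReal.ofReal (‖deriv f z‖ ^ 2) * g (f z) ≤ N * ∫⁻ w in A, g w := by
  classical
  obtain ⟨U, hUo, hUi, hSU⟩ := exists_seq_isOpen_injOn hf h0
  set T : ℕ → Set ℂ := fun n => S ∩ disjointed U n with hT
  have hTm : ∀ n, MeasurableSet (T n) := fun n =>
    hS.inter (MeasurableSet.disjointed (fun n => (hUo n).measurableSet) n)
  have hTd : Pairwise (Function.onFun Disjoint T) := fun i j hij =>
    (disjoint_disjointed U hij).mono inter_subset_right inter_subset_right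
  have hTi : ∀ n, InjOn f (T n) := fun n =>
    (hUi n).mono (inter_subset_right.trans (disjointed_subset U n))
  have hTS : ⋃ n, T n = S := by
    rw [hT, ← inter_iUnion, iUnion_disjointed]
    exact inter_eq_left.mpr hSU
  have hder : ∀ n, ∀ z ∈ T n, HasFDerivWithinAt f
      ((ContinuousLinearMap.toSpanSingleton ℂ (deriv f z)).restrictScalars ℝ) (T n) z :=
    fun n z _ => ((hf z).hasDerivAt.hasFDerivAt.restrictScalars ℝ).hasFDerivWithinAt
  have hpiece : ∀ n, ∫⁻ z in T n, ENNReal.ofReal (‖deriv f z‖ ^ 2) * g (f z)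
      = ∫⁻ w, (f '' T n).indicator g w := by
    intro n
    rw [lintegral_indicator (measurable_image_of_fderivWithin (hTm n) (hder n) (hTi n)),
      lintegral_image_eq_lintegral_abs_det_fderiv_mul volume (hTm n) (hder n) (hTi n)]
    simp_rw [abs_det_restrictScalars_smulRight]
  rw [← hTS, lintegral_iUnion hTm hTd]
  simp_rw [hpiece]
  rw [← lintegral_tsum (fun n => (hg.indicator
    (measurable_image_of_fderivWithin (hTm n) (hder n) (hTi n))).aemeasurable),
    ← lintegral_indicator hA, ← lintegral_const_mul _ (hg.indicator hA)]
  refine lintegral_mono fun w => ?_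
  rw [ENNReal.tsum_eq_iSup_sum]
  refine iSup_le fun s => ?_
  rw [Finset.sum_indicator_eq_sum_filter, Finset.sum_const, nsmul_eq_mul]
  by_cases hw : w ∈ A
  · rw [indicator_of_mem hw]
    gcongr
    have hex : ∀ n ∈ s.filter (fun n => w ∈ f '' T n), ∃ z ∈ T n, f z = w := fun n hn =>
      (Finset.mem_filter.mp hn).2
    choose! ζ hζT hζw using hex
    rw [← Finset.card_image_of_injOn (s := s.filter (fun n => w ∈ f '' T n)) (f := ζ)]
    · refine hN w _ fun z hz => ?_
      obtain ⟨n, hn, rfl⟩ := Finset.mem_image.mp hz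
      exact ⟨(hζT n hn).1, hζw n hn⟩
    · intro i hi j hj hij
      by_contra hne
      exact disjoint_left.mp (hTd hne) (hζT i hi) (hij ▸ hζT j hj)
  · have : s.filter (fun n => w ∈ f '' T n) = ∅ := by
      refine Finset.filter_eq_empty_iff.mpr fun n _ h => ?_
      obtain ⟨z, hz, rfl⟩ := h
      exact hw (hSA hz.1)
    rw [this]
    simp

lemma measurable_logArea_density : Measurable (fun z : ℂ => ENNReal.ofReal ((‖z‖ ^ 2)⁻¹)) := by
  fun_prop

lemma logArea_le_of_expanding {f : ℂ → ℂ} (hf : Differentiable ℂ f) {S A : Set ℂ}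
    (hS : MeasurableSet S) (hA : MeasurableSet A) (hSA : MapsTo f S A) {N : ℕ}
    (hN : ∀ w, ∀ s : Finset ℂ, (∀ z ∈ s, z ∈ S ∧ f z = w) → s.card ≤ N) {c : ℝ} (hc : 0 < c)
    (h : ∀ z ∈ S, z ≠ 0 ∧ f z ≠ 0 ∧ c * ‖f z‖ ≤ ‖z * deriv f z‖) :
    logArea S ≤ ENNReal.ofReal (N / c ^ 2) * logArea A := by
  have h0 : ∀ z ∈ S, deriv f z ≠ 0 := by
    intro z hz hd
    obtain ⟨-, h2, h3⟩ := h z hz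
    rw [hd, mul_zero, norm_zero] at h3
    have : 0 < c * ‖f z‖ := mul_pos hc (norm_pos_iff.mpr h2)
    linarith
  have hle : logArea S ≤ ∫⁻ z in S, ENNReal.ofReal ((c ^ 2)⁻¹) *
      (ENNReal.ofReal (‖deriv f z‖ ^ 2) * ENNReal.ofReal ((‖f z‖ ^ 2)⁻¹)) := by
    refine setLIntegral_mono' hS fun z hz => ?_
    obtain ⟨h1, h2, h3⟩ := h z hz
    rw [← ENNReal.ofReal_mul (by positivity), ← ENNReal.ofReal_mul (by positivity)]
    refine ENNReal.ofReal_le_ofReal ?_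
    have hz0 : 0 < ‖z‖ := norm_pos_iff.mpr h1
    have hf0 : 0 < ‖f z‖ := norm_pos_iff.mpr h2
    rw [norm_mul] at h3
    rw [← mul_assoc, ← div_eq_mul_inv, inv_mul_eq_div, div_div, inv_eq_one_div,
      div_le_div_iff₀ (by positivity) (by positivity), ← mul_pow, ← mul_pow, one_mul]
    exact pow_le_pow_left₀ (by positivity) (by linarith) 2
  refine hle.trans ?_
  rw [lintegral_const_mul _ (by
    have := (hf.deriv).continuous
    have := hf.continuous
    fun_prop)]
  have := lintegral_norm_deriv_sq_mul_comp_le hf hS h0 hSA hN measurable_logArea_density hA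
  calc _ ≤ ENNReal.ofReal ((c ^ 2)⁻¹) * (N * logArea A) := by gcongr; exact this
    _ = _ := by
      rw [← mul_assoc, div_eq_inv_mul, ENNReal.ofReal_mul (by positivity), ENNReal.ofReal_natCast]

lemma TranscendentalEntire.exists_logArea_preimage_le {f : ℂ → ℂ} (hf : TranscendentalEntire f)
    {ε : ℝ} (hε : 0 < ε) :
    ∃ R : ℝ, 1 ≤ R ∧ 2 ≤ nMax f R ∧ ∀ A : Set ℂ, MeasurableSet A →
      logArea {z | R ≤ ‖z‖ ∧ f z ≠ 0 ∧
        (nMax f ‖z‖ : ℝ) ^ ((1 : ℝ) / 2 + ε) ≤ ‖z * deriv f z / f z‖ ∧ f z ∈ A}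
        ≤ 2⁻¹ * logArea A := by
  set q : ℝ := 2 ^ (-(2 * ε)) with hq
  have hq0 : 0 < q := by positivity
  have hq1 : q < 1 := Real.rpow_lt_one_of_one_lt_of_neg (by norm_num) (by linarith)
  obtain ⟨k, hk⟩ : ∃ k, 2 * q ^ k / (1 - q) ≤ 1 / 2 := by
    obtain ⟨k, hk⟩ := exists_pow_lt_of_lt_one (show 0 < (1 - q) / 4 by linarith) hq1
    refine ⟨k, ?_⟩
    rw [div_le_iff₀ (by linarith)]
    linarith
  obtain ⟨R, hR⟩ := hf.exists_le_nMax (2 ^ (k + 1))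
  refine ⟨max R 1, le_max_right _ _, ?_, fun A hA => ?_⟩
  · refine le_trans ?_ (hR.trans (hf.nMax_mono (le_max_left _ _)))
    rw [pow_succ]
    have := Nat.one_le_two_pow (n := k)
    lia
  have hmeas : Measurable (fun z : ℂ => nMax f ‖z‖) :=
    hf.nMax_mono.measurable.comp measurable_norm
  have hfm : Measurable f := hf.1.continuous.measurable
  have hdm : Measurable (deriv f) := measurable_deriv f
  set S : ℕ → Set ℂ := fun j => {z | max R 1 ≤ ‖z‖ ∧ f z ≠ 0 ∧
        (nMax f ‖z‖ : ℝ) ^ ((1 : ℝ) / 2 + ε) ≤ ‖z * deriv f z / f z‖ ∧ f z ∈ A ∧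
        Nat.log 2 (nMax f ‖z‖) = k + j} with hSdef
  have hSm : ∀ j, MeasurableSet (S j) := by
    intro j
    have h1 : Measurable (fun z : ℂ => (nMax f ‖z‖ : ℝ) ^ ((1 : ℝ) / 2 + ε)) :=
      ((measurable_from_nat (f := fun n : ℕ => (n : ℝ))).comp hmeas).pow_const _
    have h2 : Measurable (fun z : ℂ => ‖z * deriv f z / f z‖) :=
      ((measurable_id.mul hdm).div hfm).norm
    exact (measurableSet_le measurable_const measurable_norm).inter
      ((hfm (measurableSet_singleton 0).compl).inter ((measurableSet_le h1 h2).inter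
      ((hfm hA).inter (hmeas (MeasurableSet.of_discrete (s := {n | Nat.log 2 n = k + j}))))))
  have hSle : ∀ j, logArea (S j) ≤ ENNReal.ofReal (2 * q ^ k * q ^ j) * logArea A := by
    intro j
    have hc : (0 : ℝ) < ((2 : ℝ) ^ (k + j)) ^ ((1 : ℝ) / 2 + ε) := by positivity
    have key := logArea_le_of_expanding hf.1 (hSm j) hA (fun z hz => hz.2.2.2.1)
      (N := 2 ^ (k + j + 1)) (c := ((2 : ℝ) ^ (k + j)) ^ ((1 : ℝ) / 2 + ε)) ?_ hc ?_
    · convert key using 3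
      push_cast
      rw [← Real.rpow_natCast _ 2, ← Real.rpow_mul (by positivity), mul_assoc, ← pow_add,
        pow_succ, hq, ← Real.rpow_natCast (2 ^ (-(2 * ε))), ← Real.rpow_mul (by norm_num),
        _root_.eq_div_iff (by positivity), ← Real.rpow_natCast 2 (k + j), ← Real.rpow_mul (by norm_num),
        mul_assoc, ← Real.rpow_add (by norm_num), mul_comm]
      congr 2
      push_cast
      ring
    · intro w s hs
      rcases s.eq_empty_or_nonempty with rfl | hne
      · simp
      obtain ⟨z, hz, hmax⟩ := s.exists_max_image (fun z => ‖z‖) hne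
      have h1 : s.card ≤ nMax f ‖z‖ := hf.card_le_nMax (a := w)
        (fun u hu => ⟨hmax u hu, (hs u hu).2⟩)
      have h2 : Nat.log 2 (nMax f ‖z‖) = k + j := (hs z hz).1.2.2.2.2
      have h3 := Nat.lt_pow_succ_log_self (b := 2) (by norm_num) (nMax f ‖z‖)
      rw [h2] at h3
      exact (h1.trans h3.le)
    · intro z hz
      obtain ⟨h1, h2, h3, h4, h5⟩ := hz
      refine ⟨norm_pos_iff.mp (by linarith [le_max_right R 1]), h2, ?_⟩
      rw [norm_div, le_div_iff₀ (norm_pos_iff.mpr h2)] at h3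
      refine le_trans ?_ h3
      gcongr
      have hn : nMax f ‖z‖ ≠ 0 := by
        have := hR.trans (hf.nMax_mono ((le_max_left R 1).trans h1))
        have := Nat.one_le_two_pow (n := k + 1)
        lia
      have := Nat.pow_log_le_self 2 hn
      rw [h5] at this
      exact_mod_cast this
  have hsub : {z | max R 1 ≤ ‖z‖ ∧ f z ≠ 0 ∧
        (nMax f ‖z‖ : ℝ) ^ ((1 : ℝ) / 2 + ε) ≤ ‖z * deriv f z / f z‖ ∧ f z ∈ A} ⊆ ⋃ j, S j := by
    rintro z ⟨h1, h2, h3, h4⟩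
    have hle : k + 1 ≤ Nat.log 2 (nMax f ‖z‖) :=
      Nat.le_log_of_pow_le (by norm_num) (hR.trans (hf.nMax_mono ((le_max_left R 1).trans h1)))
    exact mem_iUnion.mpr ⟨Nat.log 2 (nMax f ‖z‖) - k, h1, h2, h3, h4, by lia⟩
  calc _ ≤ ∑' j, logArea (S j) := (logArea_mono hsub).trans (logArea_iUnion_le S)
    _ ≤ ∑' j, ENNReal.ofReal (2 * q ^ k * q ^ j) * logArea A := ENNReal.tsum_le_tsum hSle
    _ = ENNReal.ofReal (2 * q ^ k / (1 - q)) * logArea A := by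
      rw [ENNReal.tsum_mul_right, ← ENNReal.ofReal_tsum_of_nonneg (fun j => by positivity)
        ((summable_geometric_of_lt_one hq0.le hq1).mul_left _), tsum_mul_left,
        tsum_geometric_of_lt_one hq0.le hq1, div_eq_mul_inv]
    _ ≤ 2⁻¹ * logArea A := by
      gcongr
      refine (ENNReal.ofReal_le_ofReal hk).trans ?_
      rw [one_div, ENNReal.ofReal_inv_of_pos (by norm_num)]
      simp

lemma logArea_annulus_lt_top (R : ℝ) : logArea {z | 1 ≤ ‖z‖ ∧ ‖z‖ ≤ R} < ⊤ := by
  have hm : MeasurableSet {z : ℂ | 1 ≤ ‖z‖ ∧ ‖z‖ ≤ R} :=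
    (measurableSet_le measurable_const measurable_norm).inter
      (measurableSet_le measurable_norm measurable_const)
  have h : logArea {z | 1 ≤ ‖z‖ ∧ ‖z‖ ≤ R} ≤ ∫⁻ z in {z : ℂ | 1 ≤ ‖z‖ ∧ ‖z‖ ≤ R}, 1 := by
    refine setLIntegral_mono' hm fun z hz => ?_
    refine ENNReal.ofReal_le_one.mpr (inv_le_one_of_one_le₀ (one_le_pow₀ hz.1))
  refine h.trans_lt ?_
  rw [setLIntegral_one]
  refine (measure_mono (t := closedBall (0 : ℂ) R) fun z hz => ?_).trans_lt
    measure_closedBall_lt_top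
  simpa using hz.2

/-- Points of `Δ` whose orbits escape while the derivatives grow, up to finite logarithmic area. -/
lemma TranscendentalEntire.exists_expanding_invariant_set {f : ℂ → ℂ} (hf : TranscendentalEntire f)
    {ε : ℝ} (hε : 0 < ε)
    (hyp : logArea {z : ℂ | z ∈ Delta ∧
        (‖z * deriv f z / f z‖ < (nMax f ‖z‖ : ℝ) ^ ((1 : ℝ) / 2 + ε) ∨
          ‖f z‖ < (1 + ε) * ‖z‖)} < ⊤) :
    ∃ G : Set ℂ, (∀ z ∈ G, f z ∈ G ∧ 1 ≤ ‖z‖ ∧ (1 + ε) * ‖z‖ ≤ ‖f z‖ ∧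
      Real.sqrt 2 * ‖f z‖ ≤ ‖z * deriv f z‖) ∧ logArea (Delta \ G) < ⊤ := by
  obtain ⟨R, hR1, hR2, hcontr⟩ := hf.exists_logArea_preimage_le hε
  set B : Set ℂ := {z : ℂ | z ∈ Delta ∧
        (‖z * deriv f z / f z‖ < (nMax f ‖z‖ : ℝ) ^ ((1 : ℝ) / 2 + ε) ∨
          ‖f z‖ < (1 + ε) * ‖z‖)} with hB
  have hmeas : Measurable (fun z : ℂ => nMax f ‖z‖) :=
    hf.nMax_mono.measurable.comp measurable_norm
  have hfm : Measurable f := hf.1.continuous.measurable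
  have hdm : Measurable (deriv f) := measurable_deriv f
  have hBm : MeasurableSet B := by
    have h1 : Measurable (fun z : ℂ => (nMax f ‖z‖ : ℝ) ^ ((1 : ℝ) / 2 + ε)) :=
      ((measurable_from_nat (f := fun n : ℕ => (n : ℝ))).comp hmeas).pow_const _
    have h2 : Measurable (fun z : ℂ => ‖z * deriv f z / f z‖) :=
      ((measurable_id.mul hdm).div hfm).norm
    have h3 : Measurable (fun z : ℂ => (1 + ε) * ‖z‖) := by fun_prop
    exact (measurableSet_le measurable_const measurable_norm).inter
      (MeasurableSet.union (measurableSet_lt h2 h1) (measurableSet_lt hfm.norm h3))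
  have hDm : MeasurableSet {z : ℂ | R ≤ ‖z‖} := measurableSet_le measurable_const measurable_norm
  set X : Set ℂ := {z : ℂ | R ≤ ‖z‖} \ B with hX
  have hXm : MeasurableSet X := hDm.diff hBm
  have hXprop : ∀ z ∈ X, 1 ≤ ‖z‖ ∧ f z ≠ 0 ∧ (1 + ε) * ‖z‖ ≤ ‖f z‖ ∧
      (nMax f ‖z‖ : ℝ) ^ ((1 : ℝ) / 2 + ε) ≤ ‖z * deriv f z / f z‖ := by
    rintro z ⟨hzR, hzB⟩
    have hzR' : R ≤ ‖z‖ := hzR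
    have hz1 : 1 ≤ ‖z‖ := hR1.trans hzR
    have : ¬ (‖z * deriv f z / f z‖ < (nMax f ‖z‖ : ℝ) ^ ((1 : ℝ) / 2 + ε) ∨
          ‖f z‖ < (1 + ε) * ‖z‖) := fun h => hzB ⟨hz1, h⟩
    push Not at this
    refine ⟨hz1, ?_, this.2, this.1⟩
    have h2 := this.2
    intro h0
    rw [h0, norm_zero] at h2
    nlinarith
  let A : ℕ → Set ℂ := fun n => Nat.rec ({z : ℂ | R ≤ ‖z‖} ∩ B) (fun _ A => X ∩ f ⁻¹' A) n
  have hAm : ∀ n, MeasurableSet (A n) := by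
    intro n
    induction n with
    | zero => exact hDm.inter hBm
    | succ n ih => exact hXm.inter (hfm ih)
  have hA0 : logArea (A 0) < ⊤ := (logArea_mono inter_subset_right).trans_lt hyp
  have hAle : ∀ n, logArea (A n) ≤ 2⁻¹ ^ n * logArea (A 0) := by
    intro n
    induction n with
    | zero => simp
    | succ n ih =>
      calc logArea (A (n + 1)) ≤ 2⁻¹ * logArea (A n) := by
            refine (logArea_mono ?_).trans (hcontr (A n) (hAm n))
            rintro z ⟨hz, hzA⟩
            obtain ⟨h1, h2, h3, h4⟩ := hXprop z hz
            exact ⟨hz.1, h2, h4, hzA⟩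
        _ ≤ 2⁻¹ * (2⁻¹ ^ n * logArea (A 0)) := by gcongr
        _ = _ := by rw [← mul_assoc, pow_succ']
  refine ⟨{z : ℂ | R ≤ ‖z‖} \ ⋃ n, A n, ?_, ?_⟩
  · rintro z ⟨hzR, hzA⟩
    have hzA' : ∀ n, z ∉ A n := fun n hn => hzA (mem_iUnion.mpr ⟨n, hn⟩)
    have hzX : z ∈ X := ⟨hzR, fun hb => hzA' 0 ⟨hzR, hb⟩⟩
    obtain ⟨h1, h2, h3, h4⟩ := hXprop z hzX
    have hzR' : R ≤ ‖z‖ := hzR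
    refine ⟨⟨?_, ?_⟩, h1, h3, ?_⟩
    · show R ≤ ‖f z‖
      nlinarith
    · intro h
      obtain ⟨n, hn⟩ := mem_iUnion.mp h
      exact hzA' (n + 1) ⟨hzX, hn⟩
    · rw [norm_div, le_div_iff₀ (norm_pos_iff.mpr h2)] at h4
      refine le_trans ?_ h4
      gcongr
      rw [Real.sqrt_eq_rpow]
      have h5 : (2 : ℝ) ≤ nMax f ‖z‖ := by exact_mod_cast hR2.trans (hf.nMax_mono hzR)
      calc (2 : ℝ) ^ ((1 : ℝ) / 2) ≤ 2 ^ ((1 : ℝ) / 2 + ε) :=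
            Real.rpow_le_rpow_of_exponent_le (by norm_num) (by linarith)
        _ ≤ _ := Real.rpow_le_rpow (by norm_num) h5 (by positivity)
  · have hsub : Delta \ ({z : ℂ | R ≤ ‖z‖} \ ⋃ n, A n) ⊆
        {z | 1 ≤ ‖z‖ ∧ ‖z‖ ≤ R} ∪ ⋃ n, A n := by
      rintro z ⟨hz, hz'⟩
      by_cases hzR : R ≤ ‖z‖
      · right
        by_contra h
        exact hz' ⟨hzR, h⟩
      · exact Or.inl ⟨hz, (not_le.mp hzR).le⟩
    refine (logArea_mono hsub).trans_lt ((logArea_union_le _ _).trans_lt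
      (ENNReal.add_lt_top.mpr ⟨logArea_annulus_lt_top R, ?_⟩))
    refine (logArea_iUnion_le A).trans_lt ((ENNReal.tsum_le_tsum hAle).trans_lt ?_)
    rw [ENNReal.tsum_mul_right, ENNReal.tsum_geometric]
    exact ENNReal.mul_lt_top (by simp) hA0

lemma logArea_Delta : logArea Delta = ⊤ := by
  by_contra hne
  have hm : ∀ r : ℝ, MeasurableSet {z : ℂ | r ≤ ‖z‖} := fun r =>
    measurableSet_le measurable_const measurable_norm
  have h1 : logArea Delta ≤ ENNReal.ofReal ((1 : ℕ) / 1 ^ 2) * logArea {z : ℂ | 2 ≤ ‖z‖} := by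
    refine logArea_le_of_expanding (f := fun z => 2 * z) (by fun_prop) (hm 1) (hm 2) ?_ ?_
      one_pos ?_
    · intro z hz
      have hz' : 1 ≤ ‖z‖ := hz
      show 2 ≤ ‖2 * z‖
      rw [norm_mul]
      norm_num
      linarith
    · intro w s hs
      refine Finset.card_le_one.mpr fun a ha b hb => ?_
      have := (hs a ha).2.trans (hs b hb).2.symm
      simpa using this
    · intro z hz
      have hz' : 1 ≤ ‖z‖ := hz
      have hz0 : z ≠ 0 := norm_pos_iff.mp (by linarith)
      refine ⟨hz0, by simpa using hz0, ?_⟩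
      have : deriv (fun z : ℂ => 2 * z) z = 2 := by
        simp
      rw [this, one_mul, mul_comm]
  simp only [Nat.cast_one, one_pow, div_one, ENNReal.ofReal_one, one_mul] at h1
  have hb : MeasurableSet (ball (3 / 2 : ℂ) (1 / 2)) := measurableSet_ball
  have hball : ∀ z ∈ ball (3 / 2 : ℂ) (1 / 2), 1 < ‖z‖ ∧ ‖z‖ < 2 := by
    intro z hz
    rw [mem_ball, dist_eq_norm] at hz
    have h32 : ‖(3 / 2 : ℂ)‖ = 3 / 2 := by norm_num
    have a1 := norm_sub_norm_le (3 / 2 : ℂ) z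
    have a2 := norm_sub_norm_le z (3 / 2 : ℂ)
    rw [norm_sub_rev] at a1
    constructor <;> linarith
  have h2 : logArea {z : ℂ | 2 ≤ ‖z‖} + logArea (ball (3 / 2 : ℂ) (1 / 2)) ≤ logArea Delta := by
    simp only [logArea_eq_withDensity]
    rw [← measure_union _ hb]
    · refine measure_mono ?_
      rintro z (hz | hz)
      · exact le_trans (by norm_num) (show (2 : ℝ) ≤ ‖z‖ from hz)
      · exact (hball z hz).1.le
    · exact disjoint_left.mpr fun z hz hz' => not_lt.mpr hz (hball z hz').2
  have h3 : 0 < logArea (ball (3 / 2 : ℂ) (1 / 2)) := by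
    have : ∫⁻ z in ball (3 / 2 : ℂ) (1 / 2), ENNReal.ofReal (2 ^ 2)⁻¹ ≤
        logArea (ball (3 / 2 : ℂ) (1 / 2)) := by
      refine setLIntegral_mono' hb fun z hz => ENNReal.ofReal_le_ofReal ?_
      have := hball z hz
      gcongr
      · have : 0 < ‖z‖ := by linarith
        positivity
      · exact this.2.le
    refine lt_of_lt_of_le ?_ this
    rw [setLIntegral_const]
    exact ENNReal.mul_pos (by norm_num) (measure_ball_pos _ _ (by norm_num)).ne'
  have h4 : logArea Delta + logArea (ball (3 / 2 : ℂ) (1 / 2)) ≤ logArea Delta :=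
    (add_le_add_left h1 _).trans h2
  exact absurd h4 (not_le.mpr (ENNReal.lt_add_right hne h3.ne'))

lemma volume_pos_of_logArea_diff_lt_top {X : Set ℂ} (h : logArea (Delta \ X) < ⊤) :
    0 < volume X := by
  refine pos_iff_ne_zero.mpr fun h0 => ?_
  have hX : logArea X = 0 := by
    rw [logArea_eq_withDensity]
    exact withDensity_absolutelyContinuous _ _ h0
  have : logArea Delta ≤ logArea (Delta \ X) + logArea X :=
    (logArea_mono (by simp)).trans (logArea_union_le _ _)
  rw [logArea_Delta, hX, add_zero] at this
  exact absurd h (not_lt.mpr this)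

lemma pow_mul_norm_le_norm_iterate {f : ℂ → ℂ} {G : Set ℂ} {c : ℝ} (hc : 0 ≤ c)
    (hG : ∀ z ∈ G, f z ∈ G ∧ c * ‖z‖ ≤ ‖f z‖) {z : ℂ} (hz : z ∈ G) (n : ℕ) :
    f^[n] z ∈ G ∧ c ^ n * ‖z‖ ≤ ‖f^[n] z‖ := by
  induction n with
  | zero => simpa using hz
  | succ n ih =>
    rw [Function.iterate_succ_apply']
    refine ⟨(hG _ ih.1).1, le_trans ?_ (hG _ ih.1).2⟩
    rw [pow_succ', mul_assoc]
    exact mul_le_mul_of_nonneg_left ih.2 hc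

lemma pow_mul_norm_iterate_le {f : ℂ → ℂ} (hf : Differentiable ℂ f) {G : Set ℂ} {c : ℝ}
    (hc : 0 ≤ c) (hG : ∀ z ∈ G, f z ∈ G ∧ z ≠ 0 ∧ c * ‖f z‖ ≤ ‖z * deriv f z‖) {z : ℂ}
    (hz : z ∈ G) (n : ℕ) :
    f^[n] z ∈ G ∧ c ^ n * ‖f^[n] z‖ ≤ ‖z * deriv f^[n] z‖ := by
  induction n with
  | zero => simpa using hz
  | succ n ih =>
    obtain ⟨h1, h2, h3⟩ := hG _ ih.1
    rw [Function.iterate_succ', deriv_comp z (hf _) ((hf.iterate n) z)]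
    refine ⟨h1, ?_⟩
    set w := f^[n] z with hw
    have hw0 : 0 < ‖w‖ := norm_pos_iff.mpr h2
    rw [norm_mul] at h3
    rw [norm_mul, norm_mul, Function.comp_apply, ← hw]
    have h4 := ih.2
    rw [norm_mul] at h4
    refine le_of_mul_le_mul_left ?_ hw0
    calc ‖w‖ * (c ^ (n + 1) * ‖f w‖) = (c ^ n * ‖w‖) * (c * ‖f w‖) := by ring
      _ ≤ (‖z‖ * ‖deriv f^[n] z‖) * (‖w‖ * ‖deriv f w‖) := by gcongr
      _ = _ := by ring

lemma isOpen_fatouSet (f : ℂ → ℂ) : IsOpen (fatouSet f) := by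
  rw [isOpen_iff_mem_nhds]
  rintro z ⟨U, hU, h⟩
  filter_upwards [eventually_mem_nhds_iff.mpr hU] with w hw
  exact ⟨U, hw, h⟩

lemma TranscendentalEntire.isOpenMap {f : ℂ → ℂ} (hf : TranscendentalEntire f) : IsOpenMap f := by
  have han : AnalyticOnNhd ℂ f univ := fun z _ => hf.1.analyticAt z
  rcases han.is_constant_or_isOpen isPreconnected_univ with ⟨w, hw⟩ | h
  · exact absurd ⟨Polynomial.C w, fun z => by simpa using hw z (mem_univ z)⟩ hf.2
  · exact fun s hs => h s (subset_univ s) hs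

lemma TranscendentalEntire.apply_mem_fatouSet {f : ℂ → ℂ} (hf : TranscendentalEntire f) {z : ℂ}
    (hz : z ∈ fatouSet f) : f z ∈ fatouSet f := by
  obtain ⟨U, hU, h⟩ := hz
  obtain ⟨r, hr, hrU⟩ := Metric.nhds_basis_closedBall.mem_iff.mp hU
  refine ⟨f '' closedBall z r, hf.isOpenMap.image_mem_nhds (closedBall_mem_nhds z hr),
    fun φ hφ => ?_⟩
  obtain ⟨ψ, hψ, g, hg⟩ := h (fun n => φ n + 1) (fun a b hab => Nat.succ_lt_succ (hφ hab))
  have hex : ∀ w, ∃ ζ, w ∈ f '' closedBall z r → ζ ∈ closedBall z r ∧ f ζ = w := by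
    intro w
    by_cases hw : w ∈ f '' closedBall z r
    · obtain ⟨ζ, h1, h2⟩ := hw
      exact ⟨ζ, fun _ => ⟨h1, h2⟩⟩
    · exact ⟨0, fun h => absurd h hw⟩
  choose s hs using hex
  refine ⟨ψ, hψ, fun w => g (s w), fun K hK _ δ hδ => ?_⟩
  filter_upwards [hg _ hrU (isCompact_closedBall z r) δ hδ] with n hn w hw
  obtain ⟨h1, h2⟩ := hs w (hK hw)
  have := hn (s w) h1
  rwa [Function.iterate_succ_apply, h2] at this

lemma TranscendentalEntire.iterate_mem_fatouSet {f : ℂ → ℂ} (hf : TranscendentalEntire f) {z : ℂ}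
    (hz : z ∈ fatouSet f) (n : ℕ) : f^[n] z ∈ fatouSet f := by
  induction n with
  | zero => exact hz
  | succ n ih =>
    rw [Function.iterate_succ_apply']
    exact hf.apply_mem_fatouSet ih

lemma exists_ball_subset_image_log {φ H : ℂ → ℂ} {z p : ℂ} {r : ℝ} (hr : 0 < r)
    (hH : DifferentiableOn ℂ H (ball z r)) (hexp : ∀ ζ ∈ ball z r, Complex.exp (H ζ) = φ ζ - p)
    (hd : 768 * ‖φ z - p‖ < r * ‖deriv φ z‖) : ∃ b, ball b 8 ⊆ H '' ball z r := by
  have hz : z ∈ ball z r := mem_ball_self hr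
  have hne : φ z - p ≠ 0 := by
    rw [← hexp z hz]
    exact Complex.exp_ne_zero _
  have hHd : HasDerivAt H (deriv H z) z :=
    (hH.differentiableAt (isOpen_ball.mem_nhds hz)).hasDerivAt
  have h1 : HasDerivAt φ (Complex.exp (H z) * deriv H z) z := by
    have h2 := hHd.cexp.add_const p
    refine h2.congr_of_eventuallyEq ?_
    filter_upwards [isOpen_ball.mem_nhds hz] with ζ hζ
    rw [hexp ζ hζ, sub_add_cancel]
  rw [h1.deriv, hexp z hz, norm_mul] at hd
  have hpos : 0 < ‖φ z - p‖ := norm_pos_iff.mpr hne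
  have h3 : 768 < r * ‖deriv H z‖ := by
    refine lt_of_mul_lt_mul_right ?_ hpos.le
    linarith
  have h4 : deriv H z ≠ 0 := by
    intro h0
    rw [h0, norm_zero, mul_zero] at h3
    linarith
  obtain ⟨b, hb⟩ := exists_ball_subset_image hr hH h4
  refine ⟨b, (ball_subset_ball ?_).trans hb⟩
  rw [le_div_iff₀ (by norm_num)]
  linarith

lemma norm_deriv_le_of_mapsTo_simplyConnected {φ : ℂ → ℂ} {U : Set ℂ} {z p : ℂ} {r : ℝ}
    (hr : 0 < r) (hφ : Differentiable ℂ φ) (hU : IsOpen U) (hs : IsSimplyConnected U) (hp : p ∉ U)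
    (hm : MapsTo φ (ball z r) U) : r * ‖deriv φ z‖ ≤ 768 * ‖φ z - p‖ := by
  by_contra! hd
  obtain ⟨L, hL, hLexp⟩ := exists_differentiableOn_log hU hs (g := fun w => w - p)
    (by fun_prop) (fun w hw h => hp (sub_eq_zero.mp h ▸ hw))
  obtain ⟨b, hb⟩ := exists_ball_subset_image_log (H := L ∘ φ) hr
    (hL.comp hφ.differentiableOn hm) (fun ζ hζ => hLexp _ (hm hζ)) hd
  obtain ⟨ζ, hζ, hζb⟩ := hb (mem_ball_self (by norm_num))
  have hmem : b + 2 * Real.pi * Complex.I ∈ ball b 8 := by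
    rw [mem_ball, dist_eq_norm, add_sub_cancel_left]
    simp only [norm_mul, Complex.norm_I, mul_one, Complex.norm_real, Complex.norm_ofNat,
      Real.norm_eq_abs, abs_of_pos Real.pi_pos]
    linarith [Real.pi_lt_four]
  obtain ⟨ζ', hζ', hζb'⟩ := hb hmem
  have h1 : φ ζ = φ ζ' := by
    have e1 := hLexp _ (hm hζ)
    have e2 := hLexp _ (hm hζ')
    rw [Function.comp_apply] at hζb hζb'
    rw [hζb] at e1
    rw [hζb', Complex.exp_add, Complex.exp_two_pi_mul_I, mul_one, e1] at e2
    exact sub_left_injective e2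
  rw [Function.comp_apply, h1] at hζb
  rw [Function.comp_apply, hζb] at hζb'
  have : (2 * Real.pi * Complex.I : ℂ) = 0 := by simpa using hζb'.symm
  exact Complex.two_pi_I_ne_zero this

/-- The chordal distance to `∞`. -/
noncomputable def chordalToInfty (w : ℂ) : ℝ := 2 / Real.sqrt (1 + ‖w‖ ^ 2)

lemma continuous_chordalToInfty : Continuous chordalToInfty := by
  unfold chordalToInfty
  refine continuous_const.div (by fun_prop) fun w => ?_
  positivity

lemma abs_chordalToInfty_sub_le (a b : ℂ) :
    |chordalToInfty a - chordalToInfty b| ≤ chordalDist (some a) (some b) := by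
  have hA : 0 < Real.sqrt (1 + ‖a‖ ^ 2) := by positivity
  have hB : 0 < Real.sqrt (1 + ‖b‖ ^ 2) := by positivity
  have hA2 : Real.sqrt (1 + ‖a‖ ^ 2) ^ 2 = 1 + ‖a‖ ^ 2 := Real.sq_sqrt (by positivity)
  have hB2 : Real.sqrt (1 + ‖b‖ ^ 2) ^ 2 = 1 + ‖b‖ ^ 2 := Real.sq_sqrt (by positivity)
  have hAa : ‖a‖ ≤ Real.sqrt (1 + ‖a‖ ^ 2) := Real.le_sqrt_of_sq_le (by linarith)
  have hBb : ‖b‖ ≤ Real.sqrt (1 + ‖b‖ ^ 2) := Real.le_sqrt_of_sq_le (by linarith)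
  simp only [chordalToInfty, chordalDist]
  set A := Real.sqrt (1 + ‖a‖ ^ 2)
  set B := Real.sqrt (1 + ‖b‖ ^ 2)
  have h1 : |B - A| ≤ ‖a - b‖ := by
    have h2 : |B - A| * (A + B) ≤ ‖a - b‖ * (A + B) := by
      calc |B - A| * (A + B) = |B - A| * |A + B| := by rw [abs_of_pos (by linarith : 0 < A + B)]
        _ = |(‖b‖ - ‖a‖) * (‖b‖ + ‖a‖)| := by
          rw [← abs_mul]
          congr 1
          linarith
        _ = |‖b‖ - ‖a‖| * (‖b‖ + ‖a‖) := by
          rw [abs_mul, abs_of_nonneg (by positivity : 0 ≤ ‖b‖ + ‖a‖)]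
        _ ≤ ‖b - a‖ * (A + B) := by
          have := abs_norm_sub_norm_le b a
          exact mul_le_mul this (by linarith) (by positivity) (norm_nonneg _)
        _ = _ := by rw [norm_sub_rev]
    exact le_of_mul_le_mul_right h2 (by linarith)
  have : 2 / A - 2 / B = 2 * (B - A) / (A * B) := by field_simp
  rw [this, abs_div, abs_mul, abs_of_pos (mul_pos hA hB), abs_two]
  gcongr

lemma exists_abs_chordalToInfty_sub_le (x : Option ℂ) :
    ∃ t : ℝ, ∀ a, |chordalToInfty a - t| ≤ chordalDist (some a) x := by
  cases x with
  | none =>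
    refine ⟨0, fun a => ?_⟩
    rw [sub_zero, chordalToInfty, abs_of_pos (by positivity)]
    rfl
  | some b => exact ⟨chordalToInfty b, fun a => abs_chordalToInfty_sub_le a b⟩

lemma exists_forall_iterate_chordal_lt {f : ℂ → ℂ} (hf : Continuous f) {z : ℂ}
    (hz : z ∈ fatouSet f) :
    ∃ ρ > 0, ∃ N, ∀ n ≥ N, ∀ ζ ∈ ball z ρ, ∀ ζ' ∈ ball z ρ,
      |chordalToInfty (f^[n] ζ) - chordalToInfty (f^[n] ζ')| < 1 / 2 := by
  obtain ⟨U, hU, h⟩ := hz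
  obtain ⟨r, hr, hrU⟩ := Metric.nhds_basis_closedBall.mem_iff.mp hU
  by_contra! hcon
  obtain ⟨φ, hφ, hφP⟩ := Filter.extraction_forall_of_frequently (P := fun k n : ℕ =>
    ∃ ζ ∈ ball z (r / (k + 1)), ∃ ζ' ∈ ball z (r / (k + 1)),
      1 / 2 ≤ |chordalToInfty (f^[n] ζ) - chordalToInfty (f^[n] ζ')|) (by
    intro k
    rw [Filter.frequently_atTop]
    intro N
    exact hcon (r / (k + 1)) (by positivity) N)
  obtain ⟨ψ, hψ, g, hg⟩ := h φ hφ
  choose t ht using fun ζ => exists_abs_chordalToInfty_sub_le (g ζ)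
  have hev := hg _ hrU (isCompact_closedBall z r) (1 / 20) (by norm_num)
  have hclose : ∀ᶠ n in atTop, ∀ ζ ∈ closedBall z r,
      |chordalToInfty (f^[φ (ψ n)] ζ) - t ζ| < 1 / 20 := by
    filter_upwards [hev] with n hn ζ hζ
    exact (ht ζ _).trans_lt (hn ζ hζ)
  obtain ⟨m, hm⟩ := hclose.exists
  have hcont : Continuous (fun ζ => chordalToInfty (f^[φ (ψ m)] ζ)) :=
    continuous_chordalToInfty.comp (hf.iterate _)
  obtain ⟨δ, hδ, hδm⟩ := Metric.continuousAt_iff.mp (hcont.continuousAt (x := z)) (1 / 20)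
    (by norm_num)
  have hsmall : ∀ᶠ n : ℕ in atTop, r / ((ψ n : ℝ) + 1) < δ := by
    have : Tendsto (fun n : ℕ => r / ((ψ n : ℝ) + 1)) atTop (𝓝 0) :=
      Tendsto.div_atTop tendsto_const_nhds
        (tendsto_atTop_add_const_right _ _ (tendsto_natCast_atTop_atTop.comp hψ.tendsto_atTop))
    exact this.eventually_lt_const hδ
  obtain ⟨n, hn1, hn2⟩ := (hclose.and hsmall).exists
  obtain ⟨ζ, hζ, ζ', hζ', hbig⟩ := hφP (ψ n)
  have hler : r / ((ψ n : ℝ) + 1) ≤ r :=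
    div_le_self hr.le (by linarith [Nat.cast_nonneg (α := ℝ) (ψ n)])
  have key : ∀ u ∈ ball z (r / ((ψ n : ℝ) + 1)),
      |chordalToInfty (f^[φ (ψ n)] u) - chordalToInfty (f^[φ (ψ m)] z)| < 3 / 20 := by
    intro u hu
    have hur : u ∈ closedBall z r := ball_subset_closedBall (ball_subset_ball hler hu)
    have e1 := abs_lt.mp (hn1 u hur)
    have e2 := abs_lt.mp (hm u hur)
    have e3 := abs_lt.mp (hδm (lt_trans hu hn2))
    rw [abs_lt]
    constructor <;> linarith [e1.1, e1.2, e2.1, e2.2, e3.1, e3.2]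
  have k1 := abs_lt.mp (key ζ hζ)
  have k2 := abs_lt.mp (key ζ' hζ')
  have : |chordalToInfty (f^[φ (ψ n)] ζ) - chordalToInfty (f^[φ (ψ n)] ζ')| < 1 / 2 := by
    rw [abs_lt]
    constructor <;> linarith [k1.1, k1.2, k2.1, k2.2]
  linarith

lemma one_lt_norm_of_chordalToInfty_lt {w : ℂ} (h : chordalToInfty w < 1) : 1 < ‖w‖ := by
  rw [chordalToInfty, div_lt_one (by positivity), Real.lt_sqrt (by norm_num)] at h
  nlinarith [norm_nonneg w]

lemma exists_forall_one_lt_norm_iterate {f : ℂ → ℂ} (hf : Continuous f) {z : ℂ}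
    (hz : z ∈ fatouSet f) :
    ∃ ρ > 0, ∀ ζ ∈ ball z ρ, ζ ∈ escapingSet f →
      ∀ᶠ n in atTop, ∀ w ∈ ball z ρ, 1 < ‖f^[n] w‖ := by
  obtain ⟨ρ, hρ, N, hN⟩ := exists_forall_iterate_chordal_lt hf hz
  refine ⟨ρ, hρ, fun ζ hζ hζI => ?_⟩
  filter_upwards [eventually_ge_atTop N, hζI.eventually_ge_atTop 4] with n hn h4 w hw
  have h1 := (abs_lt.mp (hN n hn w hw ζ hζ)).2
  have h2 : chordalToInfty (f^[n] ζ) ≤ 1 / 2 := by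
    rw [chordalToInfty, div_le_iff₀ (by positivity)]
    have : 4 ≤ Real.sqrt (1 + ‖f^[n] ζ‖ ^ 2) := Real.le_sqrt_of_sq_le (by nlinarith)
    linarith
  exact one_lt_norm_of_chordalToInfty_lt (by linarith)

lemma exists_forall_le_norm_iterate {f : ℂ → ℂ} (hf : Differentiable ℂ f) {z : ℂ}
    (hz : z ∈ fatouSet f) :
    ∃ ρ > 0, ∀ ζ ∈ ball z ρ, ζ ∈ escapingSet f → ∀ M : ℝ,
      ∀ᶠ n in atTop, ∀ w ∈ ball z ρ, M ≤ ‖f^[n] w‖ := by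
  obtain ⟨ρ, hρ, h⟩ := exists_forall_one_lt_norm_iterate hf.continuous hz
  refine ⟨ρ / 6, by positivity, fun ζ hζ hζI M => ?_⟩
  have hζ' : ζ ∈ ball z ρ := ball_subset_ball (by linarith) hζ
  filter_upwards [h ζ hζ' hζI, hζI.eventually_ge_atTop ((max M 1) ^ 3)] with n hn hn2 w hw
  have h1 := log_norm_le_three_mul_log_norm ((hf.iterate n).differentiableOn) hn hw hζ
  have hw1 : 1 < ‖f^[n] w‖ := hn w (ball_subset_ball (by linarith) hw)
  have hM : 0 < max M 1 := lt_max_of_lt_right one_pos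
  have h2 : 3 * Real.log (max M 1) ≤ 3 * Real.log ‖f^[n] w‖ := by
    refine le_trans ?_ h1
    have := Real.log_le_log (by positivity) hn2
    rwa [Real.log_pow] at this
  have h3 : max M 1 ≤ ‖f^[n] w‖ :=
    (Real.log_le_log_iff hM (by linarith)).mp (by linarith)
  exact (le_max_left _ _).trans h3

lemma eventually_forall_le_norm_iterate_of_fatouSet_eq_univ {f : ℂ → ℂ} (hf : Differentiable ℂ f)
    (hF : fatouSet f = univ) (hI : (escapingSet f).Nonempty) {K : Set ℂ} (hK : IsCompact K)
    (M : ℝ) : ∀ᶠ n in atTop, ∀ w ∈ K, M ≤ ‖f^[n] w‖ := by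
  have hloc : ∀ z, ∃ ρ > 0, ∀ ζ ∈ ball z ρ, ζ ∈ escapingSet f → ∀ M : ℝ,
      ∀ᶠ n in atTop, ∀ w ∈ ball z ρ, M ≤ ‖f^[n] w‖ := fun z =>
    exists_forall_le_norm_iterate hf (hF ▸ mem_univ z)
  have hsub : ∀ z, ∃ ρ > 0, ∀ ζ ∈ ball z ρ, ζ ∈ escapingSet f → ball z ρ ⊆ escapingSet f := by
    intro z
    obtain ⟨ρ, hρ, h⟩ := hloc z
    refine ⟨ρ, hρ, fun ζ hζ hζI w hw => tendsto_atTop.mpr fun M => ?_⟩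
    filter_upwards [h ζ hζ hζI M] with n hn using hn w hw
  have huniv : escapingSet f = univ := by
    refine IsClopen.eq_univ ⟨isClosed_of_closure_subset fun z hz => ?_, ?_⟩ hI
    · obtain ⟨ρ, hρ, h⟩ := hsub z
      obtain ⟨ζ, hζI, hζ⟩ := Metric.mem_closure_iff.mp hz ρ hρ
      exact h ζ (by rwa [mem_ball, dist_comm]) hζI (mem_ball_self hρ)
    · refine Metric.isOpen_iff.mpr fun z hz => ?_
      obtain ⟨ρ, hρ, h⟩ := hsub z
      exact ⟨ρ, hρ, h z (mem_ball_self hρ) hz⟩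
  refine hK.induction_on (p := fun s => ∀ᶠ n in atTop, ∀ w ∈ s, M ≤ ‖f^[n] w‖) (by simp)
    (fun s t hst ht => ht.mono fun n hn w hw => hn w (hst hw)) (fun s t hs ht => ?_)
    fun z _ => ?_
  · filter_upwards [hs, ht] with n h1 h2 w hw
    exact hw.elim (h1 w) (h2 w)
  · obtain ⟨ρ, hρ, h⟩ := hloc z
    exact ⟨ball z ρ, mem_nhdsWithin_of_mem_nhds (ball_mem_nhds z hρ),
      h z (mem_ball_self hρ) (huniv ▸ mem_univ z) M⟩

lemma eventually_lt_sqrt_two_pow (C : ℝ) : ∀ᶠ n : ℕ in atTop, C < Real.sqrt 2 ^ n :=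
  (tendsto_pow_atTop_atTop_of_one_lt (by
    rw [Real.lt_sqrt (by norm_num)]
    norm_num)).eventually_gt_atTop C

lemma TranscendentalEntire.fatouSet_ne_univ {f : ℂ → ℂ} (hf : TranscendentalEntire f) {z : ℂ}
    (hz : z ∈ escapingSet f)
    (hd : ∀ n, Real.sqrt 2 ^ n * ‖f^[n] z‖ ≤ ‖z * deriv f^[n] z‖) : fatouSet f ≠ univ := by
  intro hF
  obtain ⟨R, hR⟩ := (((isCompact_closedBall z 1).union
    ((isCompact_closedBall z 1).image hf.1.continuous)).isBounded).subset_ball 0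
  obtain ⟨p, hp⟩ := exists_polynomial_of_growth_on_circles hf.1 (C := 1) (d := 3) (by
    intro S
    obtain ⟨n, hn1, hn2, hn3⟩ := ((eventually_forall_le_norm_iterate_of_fatouSet_eq_univ hf.1 hF
      ⟨z, hz⟩ (isCompact_closedBall 0 (6 * R)) (max S 2)).and
      ((eventually_lt_sqrt_two_pow (768 * ‖z‖)).and (hz.eventually_ge_atTop 1))).exists
    have hbig : ∀ w ∈ ball (0 : ℂ) (6 * R), 1 < ‖f^[n] w‖ := fun w hw => by
      have h1 := hn1 w (ball_subset_closedBall hw)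
      have h2 := le_max_right S 2
      linarith
    have hin : ∀ w ∈ ball z 1, w ∈ ball (0 : ℂ) (6 * R / 6) ∧ f w ∈ ball (0 : ℂ) (6 * R / 6) := by
      intro w hw
      have hw' := ball_subset_closedBall hw
      rw [mul_div_cancel_left₀ R (by norm_num : (6 : ℝ) ≠ 0)]
      exact ⟨hR (Or.inl hw'), hR (Or.inr (mem_image_of_mem f hw'))⟩
    have hRpos : 0 < R := by
      have := (hin z (mem_ball_self one_pos)).1
      rw [mul_div_cancel_left₀ R (by norm_num : (6 : ℝ) ≠ 0), mem_ball_zero_iff] at this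
      exact (norm_nonneg z).trans_lt this
    have hin' : ∀ w ∈ ball (0 : ℂ) (6 * R / 6), w ∈ ball (0 : ℂ) (6 * R) := fun w hw =>
      ball_subset_ball (by linarith) hw
    obtain ⟨H, hH, hHexp⟩ := exists_differentiableOn_log isOpen_ball
      (isSimplyConnected_ball z one_pos) (hf.1.iterate n).differentiableOn (fun w hw h => by
        have := hbig w (hin' w (hin w hw).1)
        rw [h, norm_zero] at this
        linarith)
    obtain ⟨b, hb⟩ := exists_ball_subset_image_log (φ := f^[n]) (p := 0) one_pos hH
      (fun ζ hζ => by rw [hHexp ζ hζ, sub_zero]) (by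
        rw [sub_zero, one_mul]
        have h1 := hd n
        rw [norm_mul] at h1
        have hz0 : 0 < ‖z‖ := by
          rcases (norm_nonneg z).eq_or_lt with h0 | h0
          · rw [← h0, zero_mul] at h1
            have : 0 < Real.sqrt 2 ^ n * ‖f^[n] z‖ := by positivity
            linarith
          · exact h0
        refine lt_of_mul_lt_mul_left ?_ hz0.le
        refine lt_of_lt_of_le ?_ h1
        rw [← mul_assoc, mul_comm ‖z‖]
        gcongr)
    have himg : ∀ w, ‖w‖ = Real.exp b.re → ∃ ζ ∈ ball z 1, f^[n] ζ = w := by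
      intro w hw
      set u := w / Complex.exp b with hu
      have hu1 : ‖u‖ = 1 := by
        rw [hu, norm_div, hw, Complex.norm_exp, div_self (Real.exp_pos _).ne']
      have hmem : b + u.arg * Complex.I ∈ ball b 8 := by
        rw [mem_ball, dist_eq_norm, add_sub_cancel_left, norm_mul, Complex.norm_I, mul_one,
          Complex.norm_real, Real.norm_eq_abs]
        linarith [Complex.abs_arg_le_pi u, Real.pi_lt_four]
      obtain ⟨ζ, hζ, hζb⟩ := hb hmem
      refine ⟨ζ, hζ, ?_⟩
      have h1 := Complex.norm_mul_exp_arg_mul_I u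
      rw [hu1, Complex.ofReal_one, one_mul] at h1
      rw [← hHexp ζ hζ, hζb, Complex.exp_add, h1, hu,
        mul_div_cancel₀ _ (Complex.exp_ne_zero b)]
    refine ⟨Real.exp b.re, ?_, fun w hw => ?_⟩
    · obtain ⟨ζ, hζ, hζw⟩ := himg (Complex.exp b) (Complex.norm_exp b)
      have h1 := hn1 ζ (ball_subset_closedBall (hin' ζ (hin ζ hζ).1))
      rw [hζw, Complex.norm_exp] at h1
      exact (le_max_left _ _).trans h1
    · obtain ⟨ζ, hζ, rfl⟩ := himg w hw
      have h1 := log_norm_le_three_mul_log_norm (hf.1.iterate n).differentiableOn hbig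
        (hin ζ hζ).1 (hin ζ hζ).2
      have h2 := hbig _ (hin' _ (hin ζ hζ).2)
      rw [← Function.iterate_succ_apply, Function.iterate_succ_apply'] at h1 h2
      rw [one_mul, ← Real.log_le_log_iff (by linarith) (by positivity), Real.log_pow, ← hw]
      exact_mod_cast h1)
  exact hf.2 ⟨p, hp⟩

lemma TranscendentalEntire.mem_juliaSet {f : ℂ → ℂ} (hf : TranscendentalEntire f)
    (hsc : NoMultiplyConnectedFatouComponent f) {z : ℂ} (hz : z ∈ escapingSet f)
    (hd : ∀ n, Real.sqrt 2 ^ n * ‖f^[n] z‖ ≤ ‖z * deriv f^[n] z‖) : z ∈ juliaSet f := by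
  by_contra hzJ
  have hzF : z ∈ fatouSet f := not_not.mp hzJ
  obtain ⟨p, hp⟩ := (ne_univ_iff_exists_notMem _).mp (hf.fatouSet_ne_univ hz hd)
  obtain ⟨r, hr, hrF⟩ := Metric.isOpen_iff.mp (isOpen_fatouSet f) z hzF
  obtain ⟨n, hn1, hn2⟩ := ((eventually_lt_sqrt_two_pow (768 * (1 + ‖p‖) * ‖z‖ / r)).and
    (hz.eventually_ge_atTop 1)).exists
  have hmaps : MapsTo f^[n] (ball z r) (connectedComponentIn (fatouSet f) (f^[n] z)) := by
    rw [mapsTo_iff_image_subset]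
    refine IsPreconnected.subset_connectedComponentIn ?_ ⟨z, mem_ball_self hr, rfl⟩ ?_
    · exact ((convex_ball z r).isPreconnected).image _ (hf.1.iterate n).continuous.continuousOn
    · rintro _ ⟨ζ, hζ, rfl⟩
      exact hf.iterate_mem_fatouSet (hrF hζ) n
  have h1 := norm_deriv_le_of_mapsTo_simplyConnected hr (hf.1.iterate n)
    ((isOpen_fatouSet f).connectedComponentIn) (hsc _ (hf.iterate_mem_fatouSet hzF n))
    (fun h => hp (connectedComponentIn_subset _ _ h)) hmaps
  have h2 : ‖f^[n] z - p‖ ≤ (1 + ‖p‖) * ‖f^[n] z‖ := by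
    have := norm_sub_le (f^[n] z) p
    nlinarith [norm_nonneg p]
  have h3 := hd n
  rw [norm_mul] at h3
  rw [div_lt_iff₀ hr] at hn1
  have h4 : Real.sqrt 2 ^ n * r * ‖f^[n] z‖ ≤ 768 * (1 + ‖p‖) * ‖z‖ * ‖f^[n] z‖ := by
    calc Real.sqrt 2 ^ n * r * ‖f^[n] z‖ = r * (Real.sqrt 2 ^ n * ‖f^[n] z‖) := by ring
      _ ≤ r * (‖z‖ * ‖deriv f^[n] z‖) := by gcongr
      _ = ‖z‖ * (r * ‖deriv f^[n] z‖) := by ring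
      _ ≤ ‖z‖ * (768 * ((1 + ‖p‖) * ‖f^[n] z‖)) := by
        have h5 := h1.trans (mul_le_mul_of_nonneg_left h2 (by norm_num))
        exact mul_le_mul_of_nonneg_left h5 (norm_nonneg z)
      _ = _ := by ring
  have := le_of_mul_le_mul_right h4 (by linarith)
  linarith

theorem escaping_and_julia_positive_measure_of_nCount
    (f : ℂ → ℂ) (hf : TranscendentalEntire f) (ε : ℝ) (hε : 0 < ε)
    (hyp : logArea {z : ℂ | z ∈ Delta ∧
        (‖z * deriv f z / f z‖ < (nMax f ‖z‖ : ℝ) ^ ((1 : ℝ) / 2 + ε) ∨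
          ‖f z‖ < (1 + ε) * ‖z‖)} < ⊤) :
    logArea (Delta \ escapingSet f) < ⊤ ∧ 0 < volume (escapingSet f) ∧
      (NoMultiplyConnectedFatouComponent f →
        logArea (Delta \ (escapingSet f ∩ juliaSet f)) < ⊤ ∧
          0 < volume (escapingSet f ∩ juliaSet f)) := by
  obtain ⟨G, hG, hGfin⟩ := hf.exists_expanding_invariant_set hε hyp
  have hGI : G ⊆ escapingSet f := by
    intro z hz
    have hz1 := (hG z hz).2.1
    refine tendsto_atTop_mono (fun n => (pow_mul_norm_le_norm_iterate (c := 1 + ε) (by linarith)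
      (fun z hz => ⟨(hG z hz).1, (hG z hz).2.2.1⟩) hz n).2) ?_
    exact (tendsto_pow_atTop_atTop_of_one_lt (by linarith)).atTop_mul_const (by linarith)
  have h1 : logArea (Delta \ escapingSet f) < ⊤ :=
    (logArea_mono (sdiff_subset_sdiff_right hGI)).trans_lt hGfin
  refine ⟨h1, volume_pos_of_logArea_diff_lt_top h1, fun hsc => ?_⟩
  have hGJ : G ⊆ escapingSet f ∩ juliaSet f := fun z hz =>
    ⟨hGI hz, hf.mem_juliaSet hsc (hGI hz) fun n =>
      (pow_mul_norm_iterate_le hf.1 (Real.sqrt_nonneg 2) (fun z hz => ⟨(hG z hz).1,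
        norm_pos_iff.mp (by linarith [(hG z hz).2.1]), (hG z hz).2.2.2⟩) hz n).2⟩
  have h2 : logArea (Delta \ (escapingSet f ∩ juliaSet f)) < ⊤ :=
    (logArea_mono (sdiff_subset_sdiff_right hGJ)).trans_lt hGfin
  exact ⟨h2, volume_pos_of_logArea_diff_lt_top h2⟩
end

section
/- Let f be a transcendental entire function in the Eremenko–Lyubich class B. Then there exists R > 0 such that |z f'(z)/f(z)| ≥ (1/(4π)) log(|f(z)|/R) for all z ∈ ℂ with f(z) ≠ 0. -/
open MeasureTheory Filter Metric Set Topology ENNReal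

/-- An entire function of polynomial growth is a polynomial. -/
theorem Differentiable.exists_polynomial_of_norm_le {f : ℂ → ℂ} (hf : Differentiable ℂ f)
    {C r : ℝ} {m : ℕ} (hC : ∀ z : ℂ, r ≤ ‖z‖ → ‖f z‖ ≤ C * ‖z‖ ^ m) :
    ∃ p : Polynomial ℂ, ∀ z, f z = p.eval z := by
  have hzero : ∀ n, m < n → iteratedDeriv n f 0 = 0 := by
    intro n hn
    have hbound : ∀ᶠ s : ℝ in atTop, ‖iteratedDeriv n f 0‖ ≤ n.factorial * C * s⁻¹ := by
      filter_upwards [eventually_ge_atTop r, eventually_ge_atTop 1] with s hs hs1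
      have hs0 : 0 < s := by linarith
      have h := Complex.norm_iteratedDeriv_le_of_forall_mem_sphere_norm_le (c := 0) (f := f)
        (C := C * s ^ m) n hs0 hf.diffContOnCl (fun z hz => by
          have hz' : ‖z‖ = s := by simpa using hz
          simpa [hz'] using hC z (by rw [hz']; exact hs))
      have hC0 : 0 ≤ C := by
        have := (norm_nonneg _).trans (hC (s : ℂ) (by simpa [abs_of_pos hs0] using hs))
        exact nonneg_of_mul_nonneg_left this (by simp; positivity)
      refine h.trans ?_
      rw [← mul_assoc, mul_div_assoc]
      gcongr
      rw [div_le_iff₀ (by positivity), inv_mul_eq_div, le_div_iff₀ hs0, ← pow_succ]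
      exact pow_le_pow_right₀ hs1 hn
    have hlim : Tendsto (fun s : ℝ => n.factorial * C * s⁻¹) atTop (𝓝 0) := by
      simpa using tendsto_inv_atTop_zero.const_mul ((n.factorial : ℝ) * C)
    simpa using ge_of_tendsto hlim hbound
  refine ⟨∑ n ∈ Finset.range (m + 1),
    Polynomial.monomial n ((n.factorial : ℂ)⁻¹ * iteratedDeriv n f 0), fun z => ?_⟩
  have h := Complex.hasSum_taylorSeries_of_entire hf 0 z
  rw [← h.tsum_eq, tsum_eq_sum (s := Finset.range (m + 1))]
  · simp [Polynomial.eval_finsetSum, smul_eq_mul]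
    refine Finset.sum_congr rfl fun n _ => by ring
  · intro n hn
    simp [hzero n (by simpa using hn)]

/-- If an inverse branch of an entire function along the exponential map has an imaginary period,
then the function is a polynomial. -/
theorem exists_polynomial_of_periodic_exp_lift {f : ℂ → ℂ} (hf : Differentiable ℂ f) {L : ℝ}
    {G : ℂ → ℂ} (hG : DifferentiableOn ℂ G {ζ | L < ζ.re})
    (hfG : ∀ ζ, L < ζ.re → f (G ζ) = Complex.exp ζ) {m : ℕ} (hm : 0 < m)
    (hper : ∀ ζ, L < ζ.re → G (ζ + m * (2 * Real.pi * Complex.I)) = G ζ) :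
    ∃ p : Polynomial ℂ, ∀ z, f z = p.eval z := by
  classical
  have hopen : IsOpen {ζ : ℂ | L < ζ.re} := isOpen_lt continuous_const Complex.continuous_re
  have hre : ∀ x : ℂ, (-Complex.I * x).re = x.im := by simp
  set k : ℂ → ℂ := fun x => if L < x.im then (G (-Complex.I * x))⁻¹ else 0 with hk
  have hk_of : ∀ x : ℂ, L < x.im → k x = (G (-Complex.I * x))⁻¹ := fun x hx => by simp [hk, hx]
  set h : ℝ := 2 * Real.pi * m with hh
  have hh0 : 0 < h := by positivity
  have hperk : Function.Periodic k h := by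
    intro x
    have him : (x + (h : ℂ)).im = x.im := by simp
    simp only [hk, him]
    split_ifs with hx
    · rw [← hper (-Complex.I * (x + h)) (by rw [hre, him]; exact hx)]
      congr 2
      simp [hh]
      ring
    · rfl
  have hGinf : Tendsto (fun x => ‖G (-Complex.I * x)‖) (comap Complex.im atTop) atTop := by
    refine tendsto_atTop.2 fun M => ?_
    obtain ⟨K, hK⟩ := (isCompact_closedBall (0 : ℂ) M).exists_bound_of_continuousOn
      hf.continuous.continuousOn
    have hev : ∀ᶠ y : ℝ in atTop, L < y ∧ K < Real.exp y :=
      (eventually_gt_atTop L).and (Real.tendsto_exp_atTop.eventually_gt_atTop K)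
    filter_upwards [tendsto_comap.eventually hev] with x hx
    by_contra! hlt
    have h1 := hK (G (-Complex.I * x)) (by simpa using hlt.le)
    rw [hfG _ (by rw [hre]; exact hx.1), Complex.norm_exp, hre] at h1
    exact absurd hx.2 h1.not_gt
  have hlarge : ∀ A : ℝ, ∀ᶠ x : ℂ in comap Complex.im atTop, A < x.im := fun A =>
    tendsto_comap.eventually (eventually_gt_atTop A)
  have hkdiff : ∀ᶠ x in comap Complex.im atTop, DifferentiableAt ℂ k x := by
    filter_upwards [hlarge L, hGinf.eventually_gt_atTop 0] with x hx hx0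
    have h1 : DifferentiableAt ℂ (fun x => (G (-Complex.I * x))⁻¹) x := by
      have h2 : DifferentiableAt ℂ G (-Complex.I * x) :=
        (hG _ (by rw [mem_ofPred_eq, hre]; exact hx)).differentiableAt
          (hopen.mem_nhds (by rw [mem_ofPred_eq, hre]; exact hx))
      exact (DifferentiableAt.comp x h2 (by fun_prop)).inv (norm_pos_iff.1 hx0)
    refine h1.congr_of_eventuallyEq ?_
    filter_upwards [(isOpen_lt continuous_const Complex.continuous_im).mem_nhds hx] with y hy
    exact hk_of y hy
  have hkz : ZeroAtFilter (comap Complex.im atTop) k := by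
    refine tendsto_zero_iff_norm_tendsto_zero.2 (hGinf.inv_tendsto_atTop.congr' ?_)
    filter_upwards [hlarge L] with x hx
    simp [hk_of x hx]
  set c := Function.Periodic.cuspFunction h k with hc
  have hc0 : c 0 = 0 := Function.Periodic.cuspFunction_zero_of_zero_at_inf hh0 hkz
  have hcdiff : DifferentiableAt ℂ c 0 :=
    Function.Periodic.differentiableAt_cuspFunction_zero hh0 hperk hkdiff hkz.boundedAtFilter
  have hcq : ∀ q : ℂ, q ≠ 0 → c q = k (Function.Periodic.invQParam h q) := fun q hq =>
    Function.Periodic.cuspFunction_eq_of_nonzero h k hq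
  have hcan : AnalyticAt ℂ c 0 := by
    refine Complex.analyticAt_iff_eventually_differentiableAt.2 ?_
    have h1 := Function.Periodic.eventually_differentiableAt_cuspFunction_nhds_ne_zero hh0 hperk
      hkdiff
    filter_upwards [eventually_nhdsWithin_iff.1 h1] with q hq
    rcases eq_or_ne q 0 with rfl | hne
    · exact hcdiff
    · exact hq hne
  have hinv := Function.Periodic.invQParam_tendsto hh0
  have hcne : ∀ᶠ q in 𝓝[≠] (0 : ℂ), c q ≠ 0 := by
    filter_upwards [hinv.eventually (hlarge L), hinv.eventually (hGinf.eventually_gt_atTop 0),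
      self_mem_nhdsWithin] with q hq hq' hq0
    rw [hcq q hq0, hk_of _ hq]
    exact inv_ne_zero (norm_pos_iff.1 hq')
  have hmap : 𝓝 (0 : ℂ) ≤ map c (𝓝 0) := by
    have := hcan.eventually_constant_or_nhds_le_map_nhds
    rw [hc0] at this
    refine this.resolve_left fun hconst => ?_
    obtain ⟨q, hq, hq'⟩ := (hcne.and (hconst.filter_mono nhdsWithin_le_nhds)).exists
    exact hq hq'
  obtain ⟨C, hC0, hC⟩ := hcdiff.isBigO_sub.exists_pos
  have hev : ∀ᶠ q in 𝓝 (0 : ℂ), q ≠ 0 → ‖c q‖ ≤ C * ‖q‖ ∧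
      L < (Function.Periodic.invQParam h q).im := by
    refine eventually_nhdsWithin_iff.1 ?_
    filter_upwards [hinv.eventually (hlarge L), hC.bound.filter_mono nhdsWithin_le_nhds]
      with q hq hq'
    exact ⟨by simpa [hc0] using hq', hq⟩
  have hev' : ∀ᶠ v in 𝓝 (0 : ℂ), v ≠ 0 → ‖f v⁻¹‖ ≤ C ^ m * ‖v⁻¹‖ ^ m := by
    filter_upwards [hmap (image_mem_map hev)] with v hv hv0
    obtain ⟨q, hq, rfl⟩ := hv
    have hq0 : q ≠ 0 := by
      rintro rfl
      exact hv0 hc0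
    obtain ⟨hqC, hqL⟩ := hq hq0
    set x := Function.Periodic.invQParam h q with hx
    have hcx : (c q)⁻¹ = G (-Complex.I * x) := by rw [hcq q hq0, ← hx, hk_of x hqL, inv_inv]
    have hq_norm : ‖q‖ = Real.exp (-(x.im / m)) := by
      have h1 := Function.Periodic.norm_qParam h x
      rw [hx, Function.Periodic.qParam_right_inv hh0.ne' hq0, ← hx] at h1
      rw [h1, hh]
      congr 1
      have := Real.pi_pos.ne'
      field_simp
    have hfx : ‖f (c q)⁻¹‖ = (‖q‖⁻¹) ^ m := by
      rw [hcx, hfG _ (by rw [hre]; exact hqL), Complex.norm_exp, hre, hq_norm, Real.exp_neg,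
        inv_inv, ← Real.exp_nat_mul]
      congr 1
      field_simp
    rw [hfx, ← mul_pow]
    gcongr
    rw [norm_inv, ← div_eq_mul_inv, inv_le_iff_one_le_mul₀ (norm_pos_iff.2 hq0), div_mul_eq_mul_div,
      one_le_div (norm_pos_iff.2 hv0)]
    exact hqC
  obtain ⟨ε, hε, hball⟩ := Metric.eventually_nhds_iff_ball.1 hev'
  refine hf.exists_polynomial_of_norm_le (C := C ^ m) (r := ε⁻¹ + 1) (m := m) fun z hz => ?_
  have hz0 : 0 < ‖z‖ := (by positivity : 0 < ε⁻¹ + 1).trans_le hz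
  have := hball z⁻¹ (by
    rw [mem_ball_zero_iff, norm_inv]
    exact inv_lt_of_inv_lt₀ hε (by linarith)) (inv_ne_zero (norm_pos_iff.1 hz0))
  simpa using this

/-- For a transcendental entire function the inverse branches along the exponential map are
injective. -/
theorem injOn_exp_lift {f : ℂ → ℂ} (hf : Differentiable ℂ f)
    (htr : ¬ ∃ p : Polynomial ℂ, ∀ z, f z = p.eval z) {L : ℝ}
    {G : ℂ → ℂ} (hG : DifferentiableOn ℂ G {ζ | L < ζ.re})
    (hfG : ∀ ζ, L < ζ.re → f (G ζ) = Complex.exp ζ)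
    (hderiv : ∀ ζ, L < ζ.re → deriv f (G ζ) ≠ 0) : InjOn G {ζ | L < ζ.re} := by
  have hopen : IsOpen {ζ : ℂ | L < ζ.re} := isOpen_lt continuous_const Complex.continuous_re
  have hperiod : ∀ ζ : ℂ, L < ζ.re → ∀ m : ℕ, 0 < m →
      G (ζ + m * (2 * Real.pi * Complex.I)) ≠ G ζ := by
    intro ζ hζ m hm heq
    have hre : ∀ x : ℂ, (x + m * (2 * Real.pi * Complex.I)).re = x.re := by simp
    refine htr (exists_polynomial_of_periodic_exp_lift hf hG hfG hm ?_)
    have hG' : DifferentiableOn ℂ (fun x => G (x + m * (2 * Real.pi * Complex.I)))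
        {ζ | L < ζ.re} :=
      hG.comp (by fun_prop) fun x hx => by rw [mem_ofPred_eq, hre]; exact hx
    have hmem := hopen.mem_nhds hζ
    have hs := (hf.analyticAt (G ζ)).hasStrictDerivAt
    have hleft := hs.eventually_left_inverse (hderiv ζ hζ)
    have hloc : (fun x => G (x + m * (2 * Real.pi * Complex.I))) =ᶠ[𝓝 ζ] G := by
      have h1 : Tendsto G (𝓝 ζ) (𝓝 (G ζ)) := (hG.continuousOn.continuousAt hmem).tendsto
      have h2 : Tendsto (fun x => G (x + m * (2 * Real.pi * Complex.I))) (𝓝 ζ) (𝓝 (G ζ)) := by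
        have := (hG'.continuousOn.continuousAt hmem).tendsto
        rwa [heq] at this
      filter_upwards [h1.eventually hleft, h2.eventually hleft, hmem] with x hx1 hx2 hx
      rw [← hx1, ← hx2, hfG x hx, hfG _ (by rw [hre]; exact hx), Complex.exp_add,
        Complex.exp_nat_mul_two_pi_mul_I, mul_one]
    exact (hG'.analyticOnNhd hopen).eqOn_of_preconnected_of_eventuallyEq (hG.analyticOnNhd hopen)
      (convex_halfSpace_re_gt L).isPreconnected hζ hloc
  intro ζ₁ h₁ ζ₂ h₂ heq
  have hexp : Complex.exp ζ₁ = Complex.exp ζ₂ := by rw [← hfG ζ₁ h₁, ← hfG ζ₂ h₂, heq]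
  obtain ⟨n, hn⟩ := Complex.exp_eq_exp_iff_exists_int.1 hexp
  obtain ⟨k, rfl | rfl⟩ := n.eq_nat_or_neg
  · rcases Nat.eq_zero_or_pos k with rfl | hk
    · simpa using hn
    · exact absurd (by rw [← heq, hn]; simp) (hperiod ζ₂ h₂ k hk)
  · rcases Nat.eq_zero_or_pos k with rfl | hk
    · simpa using hn
    · refine absurd ?_ (hperiod ζ₁ h₁ k hk)
      rw [heq, hn]
      simp

/-- A path lifts through a local homeomorphism as soon as every lift of a proper initial piece
of it has a cluster point at its end. -/
theorem IsLocalHomeomorph.exists_lift_of_mapClusterPt {E X : Type*} [TopologicalSpace E]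
    [TopologicalSpace X] [T2Space E] [T2Space X] {p : E → X} (hp : IsLocalHomeomorph p)
    {γ : ℝ → X} (hγ : Continuous γ) {e₀ : E} (he₀ : p e₀ = γ 0)
    (hcl : ∀ T ∈ Ioc (0 : ℝ) 1, ∀ Γ : ℝ → E, ContinuousOn Γ (Ico 0 T) →
      (∀ t ∈ Ico 0 T, p (Γ t) = γ t) → ∃ e, MapClusterPt e (𝓝[<] T) Γ) :
    ∃ Γ : ℝ → E, ContinuousOn Γ (Icc 0 1) ∧ Γ 0 = e₀ ∧ ∀ t ∈ Icc (0 : ℝ) 1, p (Γ t) = γ t := by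
  classical
  have : Nonempty E := ⟨e₀⟩
  set S : Set ℝ := {T | T ∈ Icc (0 : ℝ) 1 ∧ ∃ Γ : ℝ → E, ContinuousOn Γ (Icc 0 T) ∧ Γ 0 = e₀ ∧
    ∀ t ∈ Icc (0 : ℝ) T, p (Γ t) = γ t} with hS
  have extend : ∀ (e : E) (b : ℝ), 0 ≤ b → p e = γ b → ∃ U ∈ 𝓝 e, ∃ ε > 0, ∀ t₁ ∈ Icc (b - ε) b,
      ∀ Γ : ℝ → E, 0 ≤ t₁ → ContinuousOn Γ (Icc 0 t₁) → Γ 0 = e₀ →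
      (∀ t ∈ Icc (0 : ℝ) t₁, p (Γ t) = γ t) → Γ t₁ ∈ U → ∀ T ∈ Icc t₁ (b + ε), T ≤ 1 → T ∈ S := by
    intro e b hb heb
    obtain ⟨q, heq, rfl⟩ := hp e
    have hnhds : γ ⁻¹' q.target ∈ 𝓝 b :=
      hγ.continuousAt.preimage_mem_nhds
        (q.open_target.mem_nhds (by rw [← heb]; exact q.map_source heq))
    obtain ⟨ε, hε, hball⟩ := Metric.nhds_basis_closedBall.mem_iff.1 hnhds
    rw [Real.closedBall_eq_Icc] at hball
    refine ⟨q.source, q.open_source.mem_nhds heq, ε, hε, ?_⟩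
    intro t₁ ht₁ Γ h0 hΓ hΓ0 hlift hU T hT hT1
    have htarget : ∀ t ∈ Icc t₁ T, γ t ∈ q.target := fun t ht =>
      hball ⟨ht₁.1.trans ht.1, ht.2.trans hT.2⟩
    have hmatch : Γ t₁ = q.symm (γ t₁) := by
      rw [← hlift t₁ ⟨h0, le_rfl⟩, q.left_inv hU]
    refine ⟨⟨h0.trans hT.1, hT1⟩, fun t => if t ≤ t₁ then Γ t else q.symm (γ t),
      ?_, by simp [h0, hΓ0], ?_⟩
    · have hcover : Icc (0 : ℝ) T = Icc 0 t₁ ∪ Icc t₁ T := (Icc_union_Icc_eq_Icc h0 hT.1).symm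
      rw [hcover]
      refine ContinuousOn.union_of_isClosed ?_ ?_ isClosed_Icc isClosed_Icc
      · exact hΓ.congr fun t ht => by simp [ht.2]
      · have : ContinuousOn (fun t => q.symm (γ t)) (Icc t₁ T) :=
          q.continuousOn_symm.comp hγ.continuousOn htarget
        refine this.congr fun t ht => ?_
        rcases ht.1.eq_or_lt with h | h
        · simp [← h, hmatch]
        · simp [not_le.2 h]
    · intro t ht
      by_cases h : t ≤ t₁
      · simpa [h] using hlift t ⟨ht.1, h⟩
      · simpa [h] using q.right_inv (htarget t ⟨(not_le.1 h).le, ht.2⟩)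
  have hS0 : (0 : ℝ) ∈ S :=
    ⟨⟨le_rfl, zero_le_one⟩, fun _ => e₀, continuousOn_const, rfl, fun t ht => by
      obtain rfl : t = 0 := by simpa using ht
      exact he₀⟩
  have hbdd : BddAbove S := ⟨1, fun T hT => hT.1.2⟩
  set b := sSup S with hb
  have hb0 : 0 ≤ b := le_csSup hbdd hS0
  have hb1 : b ≤ 1 := csSup_le ⟨0, hS0⟩ fun T hT => hT.1.2
  suffices h : ∃ ε > 0, ∀ T, b ≤ T → T ≤ b + ε → T ≤ 1 → T ∈ S by
    obtain ⟨ε, hε, h⟩ := h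
    have hmin := h (min 1 (b + ε)) (le_min hb1 (by linarith)) (min_le_right _ _) (min_le_left _ _)
    have hle := le_csSup hbdd hmin
    have h1 : 1 ∈ S := by
      rcases le_total 1 (b + ε) with h' | h'
      · rwa [min_eq_left h'] at hmin
      · rw [min_eq_right h', ← hb] at hle; linarith
    exact h1.2
  rcases hb0.eq_or_lt with hb0' | hbpos
  · obtain ⟨U, hU, ε, hε, h⟩ := extend e₀ 0 le_rfl he₀
    obtain ⟨-, Γ, hΓ, hΓ0, hlift⟩ := hS0
    refine ⟨ε, hε, fun T hT hT' hT1 => ?_⟩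
    rw [← hb0'] at hT hT'
    exact h 0 ⟨by linarith, le_rfl⟩ Γ le_rfl hΓ hΓ0 hlift (by rw [hΓ0]; exact mem_of_mem_nhds hU)
      T ⟨hT, hT'⟩ hT1
  · have hlt : ∀ T ∈ Ico 0 b, ∃ Γ : ℝ → E, ContinuousOn Γ (Icc 0 T) ∧ Γ 0 = e₀ ∧
        ∀ t ∈ Icc (0 : ℝ) T, p (Γ t) = γ t := by
      intro T hT
      obtain ⟨T', hT', hTT'⟩ := exists_lt_of_lt_csSup ⟨0, hS0⟩ hT.2
      obtain ⟨-, Γ, hΓ, hΓ0, hlift⟩ := hT'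
      have hsub : Icc (0 : ℝ) T ⊆ Icc 0 T' := Icc_subset_Icc_right hTT'.le
      exact ⟨Γ, hΓ.mono hsub, hΓ0, fun t ht => hlift t (hsub ht)⟩
    choose! Λ hΛc hΛ0 hΛ using hlt
    have hagree : ∀ T ∈ Ico 0 b, EqOn (fun t => Λ t t) (Λ T) (Icc 0 T) := by
      intro T hT t ht
      have htb : t ∈ Ico 0 b := ⟨ht.1, ht.2.trans_lt hT.2⟩
      refine (T2Space.isSeparatedMap p).eqOn_of_comp_eqOn hp.isLocallyInjective
        (isPreconnected_Icc (a := 0) (b := t)) (hΛc t htb)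
        ((hΛc T hT).mono (Icc_subset_Icc_right ht.2)) (fun s hs => ?_)
        ⟨le_rfl, ht.1⟩ ?_ ⟨ht.1, le_rfl⟩
      · simp [hΛ t htb s hs, hΛ T hT s ⟨hs.1, hs.2.trans ht.2⟩]
      · rw [hΛ0 t htb, hΛ0 T hT]
    have hcont : ContinuousOn (fun t => Λ t t) (Ico 0 b) := by
      intro t ht
      obtain ⟨T, htT, hTb⟩ := exists_between ht.2
      have hT : T ∈ Ico 0 b := ⟨ht.1.trans htT.le, hTb⟩
      have h1 : ContinuousWithinAt (fun t => Λ t t) (Icc 0 T) t :=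
        ((hΛc T hT).congr (hagree T hT)) t ⟨ht.1, htT.le⟩
      refine h1.mono_of_mem_nhdsWithin ?_
      filter_upwards [self_mem_nhdsWithin, mem_nhdsWithin_of_mem_nhds (Iio_mem_nhds htT)]
        with s hs hs'
      exact ⟨hs.1, le_of_lt hs'⟩
    obtain ⟨e, he⟩ := hcl b ⟨hbpos, hb1⟩ (fun t => Λ t t) hcont fun t ht => hΛ t ht t ⟨ht.1, le_rfl⟩
    have hmem : Ico 0 b ∈ 𝓝[<] b := Ico_mem_nhdsLT hbpos
    have hpe : p e = γ b := by
      have h1 : MapClusterPt (p e) (𝓝[<] b) (p ∘ fun t => Λ t t) :=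
        he.continuousAt_comp hp.continuous.continuousAt
      have h2 : Tendsto (p ∘ fun t => Λ t t) (𝓝[<] b) (𝓝 (γ b)) := by
        refine (hγ.continuousAt.tendsto.mono_left nhdsWithin_le_nhds).congr' ?_
        filter_upwards [hmem] with t ht
        exact (hΛ t ht t ⟨ht.1, le_rfl⟩).symm
      by_contra hne
      exact (h1.clusterPt.neBot.mono (inf_le_inf_left _ h2)).ne
        ((disjoint_nhds_nhds.2 hne).eq_bot)
    obtain ⟨U, hU, ε, hε, h⟩ := extend e b hb0 hpe
    have hfreq := he.frequently hU
    have hev : ∀ᶠ t in 𝓝[<] b, t ∈ Ico 0 b ∧ b - ε < t :=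
      (eventually_mem_set.2 hmem).and
        (mem_nhdsWithin_of_mem_nhds (Ioi_mem_nhds (by linarith)))
    obtain ⟨t₁, ht₁U, ht₁, ht₁'⟩ := (hfreq.and_eventually hev).exists
    exact ⟨ε, hε, fun T hT hT' hT1 => h t₁ ⟨ht₁'.le, ht₁.2.le⟩ (Λ t₁) ht₁.1 (hΛc t₁ ht₁)
      (hΛ0 t₁ ht₁) (hΛ t₁ ht₁) ht₁U T ⟨ht₁.2.le.trans hT, hT'⟩ hT1⟩

/-- A path mapped by a continuous `f` to a convergent path has a cluster point, unless the limit
is an asymptotic value. -/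
theorem exists_mapClusterPt_of_notMem_asymptoticValues {f : ℂ → ℂ} {a : ℂ}
    (ha : a ∉ asymptoticValues f) {T : ℝ} (hT : 0 < T) {Γ : ℝ → ℂ}
    (hΓ : ContinuousOn Γ (Ico 0 T)) (hlim : Tendsto (f ∘ Γ) (𝓝[<] T) (𝓝 a)) :
    ∃ z, MapClusterPt z (𝓝[<] T) Γ := by
  by_contra! hno
  refine ha ⟨fun s => Γ (T - T / (1 + |s|)), ?_, ?_, ?_⟩
  · have hc : Continuous fun s : ℝ => T - T / (1 + |s|) := by
      refine continuous_const.sub (continuous_const.div (by fun_prop) fun s => ?_)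
      positivity
    refine hΓ.comp_continuous hc fun s => ⟨?_, ?_⟩
    · have : T / (1 + |s|) ≤ T := div_le_self hT.le (by linarith [abs_nonneg s])
      linarith
    · have : 0 < T / (1 + |s|) := by positivity
      linarith
  all_goals
    have hφ : Tendsto (fun s : ℝ => T - T / (1 + |s|)) atTop (𝓝[<] T) := by
      refine tendsto_nhdsWithin_iff.2 ⟨?_, .of_forall fun s => ?_⟩
      · have h1 : Tendsto (fun s : ℝ => 1 + |s|) atTop atTop :=
          tendsto_atTop_add_const_left _ _ tendsto_abs_atTop_atTop
        simpa using (h1.const_div_atTop T).const_sub T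
      · have : 0 < T / (1 + |s|) := by positivity
        simpa using this
  · have hinf : Tendsto Γ (𝓝[<] T) (cocompact ℂ) := by
      refine (hasBasis_cocompact.tendsto_right_iff).2 fun K hK => ?_
      by_contra hfr
      obtain ⟨z, -, hz⟩ := hK.exists_mapClusterPt_of_frequently
        ((not_eventually.1 hfr).mono fun t ht => not_not.1 ht)
      exact hno z hz
    exact (tendsto_norm_cocompact_atTop.comp hinf).comp hφ
  · exact hlim.comp hφ

theorem isLocalHomeomorph_restrict_of_deriv_ne_zero {f : ℂ → ℂ} (hf : Differentiable ℂ f)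
    {U : Set ℂ} (hU : IsOpen U) (hderiv : ∀ z ∈ U, deriv f z ≠ 0) :
    IsLocalHomeomorph fun z : U => f z := by
  have h1 : IsLocalHomeomorphOn f U := by
    refine IsLocalHomeomorphOn.mk f U fun z hz => ?_
    have h := hf.analyticAt z |>.hasStrictDerivAt
    have h' := h.hasStrictFDerivAt_equiv (hderiv z hz)
    exact ⟨h'.toOpenPartialHomeomorph f, h'.mem_toOpenPartialHomeomorph_source, fun _ _ => rfl⟩
  have h2 : IsLocalHomeomorph ((↑) : U → ℂ) := hU.isOpenEmbedding_subtypeVal.isLocalHomeomorph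
  exact isLocalHomeomorph_iff_isLocalHomeomorphOn_univ.2
    (h1.comp h2.isLocalHomeomorphOn fun z _ => z.2)

/-- A continuous right factor of a holomorphic map through a map with nonvanishing derivative is
holomorphic. -/
theorem DifferentiableAt.of_comp_eventuallyEq {f G g : ℂ → ℂ} {ζ : ℂ}
    (hf : Differentiable ℂ f) (hderiv : deriv f (G ζ) ≠ 0) (hG : ContinuousAt G ζ)
    (hg : DifferentiableAt ℂ g ζ) (h : ∀ᶠ x in 𝓝 ζ, f (G x) = g x) : DifferentiableAt ℂ G ζ := by
  have hs := hf.analyticAt (G ζ) |>.hasStrictDerivAt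
  have hinv := (hs.to_localInverse hderiv).hasDerivAt
  have hleft := hG.eventually (hs.eventually_left_inverse hderiv)
  rw [h.self_of_nhds] at hinv
  refine (hinv.differentiableAt.comp ζ hg).congr_of_eventuallyEq ?_
  filter_upwards [hleft, h] with x hx hx'
  rw [Function.comp_apply, ← hx', hx]

/-- Inverse branches of `f` along the exponential map exist over a half-plane whose image under
the exponential contains no singular value. -/
theorem exists_exp_lift {f : ℂ → ℂ} (hf : Differentiable ℂ f) {R : ℝ} (hR : 0 < R)
    (hcrit : ∀ z, R < ‖f z‖ → deriv f z ≠ 0) (hasym : ∀ a ∈ asymptoticValues f, ‖a‖ ≤ R)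
    {ζ₀ z₀ : ℂ} (hζ₀ : Real.log R < ζ₀.re) (hz₀ : f z₀ = Complex.exp ζ₀) :
    ∃ G : ℂ → ℂ, G ζ₀ = z₀ ∧ DifferentiableOn ℂ G {ζ | Real.log R < ζ.re} ∧
      ∀ ζ, Real.log R < ζ.re → f (G ζ) = Complex.exp ζ := by
  classical
  set U : Set ℂ := {z | R < ‖f z‖} with hU
  have hUo : IsOpen U := isOpen_lt continuous_const hf.continuous.norm
  have hp := isLocalHomeomorph_restrict_of_deriv_ne_zero hf hUo hcrit
  have hexp : ∀ ζ : ℂ, Real.log R < ζ.re → R < ‖Complex.exp ζ‖ := fun ζ hζ => by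
    rwa [Complex.norm_exp, ← Real.log_lt_iff_lt_exp hR]
  set H : Set ℂ := {ζ | Real.log R < ζ.re} with hH
  have hHo : IsOpen H := isOpen_lt continuous_const Complex.continuous_re
  have hHc : Convex ℝ H := convex_halfSpace_re_gt _
  let e₀ : U := ⟨z₀, by rw [hU, mem_ofPred_eq, hz₀]; exact hexp _ hζ₀⟩
  have key : ∀ ζ : H, ∃ Γ : ℝ → U, ContinuousOn Γ (Icc 0 1) ∧ Γ 0 = e₀ ∧
      ∀ t ∈ Icc (0 : ℝ) 1, f (Γ t) = Complex.exp (AffineMap.lineMap ζ₀ (ζ : ℂ) t) := by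
    intro ζ
    have hγ : Continuous fun t : ℝ => Complex.exp (AffineMap.lineMap ζ₀ (ζ : ℂ) t) :=
      Complex.continuous_exp.comp AffineMap.lineMap_continuous
    refine hp.exists_lift_of_mapClusterPt hγ (by simpa [e₀] using hz₀) ?_
    intro T hT Γ hΓ hlift
    have hTH : AffineMap.lineMap ζ₀ (ζ : ℂ) T ∈ H :=
      hHc.lineMap_mem hζ₀ ζ.2 ⟨hT.1.le, hT.2⟩
    have hlim : Tendsto (f ∘ fun t => (Γ t : ℂ)) (𝓝[<] T)
        (𝓝 (Complex.exp (AffineMap.lineMap ζ₀ (ζ : ℂ) T))) := by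
      refine (hγ.continuousAt.tendsto.mono_left nhdsWithin_le_nhds).congr' ?_
      filter_upwards [Ico_mem_nhdsLT hT.1] with t ht
      exact (hlift t ht).symm
    obtain ⟨z, hz⟩ := exists_mapClusterPt_of_notMem_asymptoticValues
      (fun h => (hasym _ h).not_gt (hexp _ hTH)) hT.1
      (continuous_subtype_val.comp_continuousOn hΓ) hlim
    have hfz : f z = Complex.exp (AffineMap.lineMap ζ₀ (ζ : ℂ) T) := by
      have h1 := hz.continuousAt_comp hf.continuous.continuousAt
      by_contra hne
      exact (h1.clusterPt.neBot.mono (inf_le_inf_left _ hlim)).ne (disjoint_nhds_nhds.2 hne).eq_bot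
    have hzU : z ∈ U := by rw [hU, mem_ofPred_eq, hfz]; exact hexp _ hTH
    refine ⟨⟨z, hzU⟩, mapClusterPt_iff_frequently.2 fun s hs => ?_⟩
    obtain ⟨s', hs', hsub⟩ := (mem_nhds_induced _ _ _).1 hs
    exact (hz.frequently hs').mono fun t ht => hsub ht
  choose Γ hΓ hΓ0 hlift using key
  let g : unitInterval × H → U := fun x => Γ x.2 x.1
  let F : C(unitInterval × H, ℂ) :=
    ⟨fun x => Complex.exp (AffineMap.lineMap ζ₀ (x.2 : ℂ) (x.1 : ℝ)), by
      simp only [AffineMap.lineMap_apply_module]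
      fun_prop⟩
  have hg : Continuous g := by
    refine hp.continuous_lift (T2Space.isSeparatedMap _) F ?_ ?_ ?_
    · ext x
      exact hlift x.2 x.1 x.1.2
    · simpa [g, hΓ0] using continuous_const
    · intro ζ
      exact (hΓ ζ).comp_continuous continuous_subtype_val fun t => t.2
  let G : ℂ → ℂ := fun ζ => if h : ζ ∈ H then (Γ ⟨ζ, h⟩ 1 : ℂ) else 0
  have hGf : ∀ ζ, Real.log R < ζ.re → f (G ζ) = Complex.exp ζ := by
    intro ζ hζ
    have h := hlift ⟨ζ, hζ⟩ 1 ⟨zero_le_one, le_rfl⟩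
    have hζ' : ζ ∈ H := hζ
    simpa [G, hζ'] using h
  have hGc : ContinuousOn G H := by
    rw [continuousOn_iff_continuous_domRestrict]
    have h1 : Continuous fun ζ : H => (g (1, ζ) : ℂ) := by fun_prop
    refine h1.congr fun ζ => ?_
    simp [G, g]
  refine ⟨G, ?_, fun ζ hζ => ?_, hGf⟩
  · have hζ₀' : ζ₀ ∈ H := hζ₀
    have hconst : ∀ t ∈ Icc (0 : ℝ) 1, Γ ⟨ζ₀, hζ₀⟩ t = e₀ := by
      have := (T2Space.isSeparatedMap _).eqOn_of_comp_eqOn hp.isLocallyInjective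
        (isPreconnected_Icc (a := (0 : ℝ)) (b := 1)) (hΓ ⟨ζ₀, hζ₀⟩)
        (continuousOn_const (c := e₀)) (fun t ht => ?_) (a := 0) (by simp) (hΓ0 _)
      · exact fun t ht => this ht
      · simp [hlift ⟨ζ₀, hζ₀⟩ t ht, e₀, hz₀]
    simp [G, hζ₀', hconst 1 (by simp), e₀]
  · refine (DifferentiableAt.of_comp_eventuallyEq hf ?_ (hGc.continuousAt (hHo.mem_nhds hζ))
      Complex.differentiable_exp.differentiableAt ?_).differentiableWithinAt
    · exact hcrit _ (by rw [hGf ζ hζ]; exact hexp ζ hζ)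
    · filter_upwards [hHo.mem_nhds hζ] with x hx using hGf x hx

/-- If `‖p z‖ * (1 - ‖z‖ ^ 2)` is maximal at the origin, then `p` has vanishing derivative there. -/
theorem deriv_eq_zero_of_norm_mul_le {p : ℂ → ℂ} (hp : DifferentiableAt ℂ p 0) (hp0 : p 0 ≠ 0)
    (hle : ∀ z ∈ ball (0 : ℂ) 1, ‖p z‖ * (1 - ‖z‖ ^ 2) ≤ ‖p 0‖) : deriv p 0 = 0 := by
  by_contra hb
  set b := deriv p 0 with hb_def
  set v : ℂ := p 0 / b with hv
  have hline : HasDerivAt (fun x : ℝ => p (x * v)) (b * v) 0 := by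
    have h1 : HasDerivAt (fun x : ℝ => (x : ℂ) * v) v 0 := by
      simpa using (Complex.ofRealCLM.hasDerivAt (x := (0 : ℝ))).mul_const v
    have h2 : HasDerivAt p b ((0 : ℝ) * v) := by
      simpa only [Complex.ofReal_zero, zero_mul] using hp.hasDerivAt
    exact h2.comp (0 : ℝ) h1
  have hbv : b * v = p 0 := by rw [hv]; field_simp
  have hsq := hline.norm_sq
  have hquad : HasDerivAt (fun x : ℝ => (1 - x ^ 2 * ‖v‖ ^ 2) ^ 2) 0 0 := by
    have : HasDerivAt (fun x : ℝ => 1 - x ^ 2 * ‖v‖ ^ 2) (-(2 * (0 : ℝ) * ‖v‖ ^ 2)) 0 := by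
      simpa using ((hasDerivAt_pow 2 (0 : ℝ)).mul_const (‖v‖ ^ 2)).const_sub 1
    simpa using! this.pow 2
  have hprod := hsq.mul hquad
  have hmax : IsLocalMax
      ((fun x : ℝ => ‖p (x * v)‖ ^ 2) * fun x : ℝ => (1 - x ^ 2 * ‖v‖ ^ 2) ^ 2) 0 := by
    have hcont : Tendsto (fun x : ℝ => (x : ℂ) * v) (𝓝 0) (𝓝 0) := by
      have : Continuous fun x : ℝ => (x : ℂ) * v := by fun_prop
      simpa using this.tendsto 0
    filter_upwards [hcont.eventually (ball_mem_nhds (0 : ℂ) one_pos)] with x hx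
    have h1 := hle _ hx
    have h2 : ‖(x : ℂ) * v‖ ^ 2 = x ^ 2 * ‖v‖ ^ 2 := by simp [mul_pow]
    have h3 : ‖(x : ℂ) * v‖ < 1 := by simpa using hx
    rw [h2] at h1
    have h4 : 0 ≤ 1 - x ^ 2 * ‖v‖ ^ 2 := by
      rw [← h2]; nlinarith [norm_nonneg ((x : ℂ) * v)]
    simp only [Pi.mul_apply]
    rw [← mul_pow]
    simpa using pow_le_pow_left₀ (mul_nonneg (norm_nonneg _) h4) h1 2
  have hzero := hmax.hasDerivAt_eq_zero hprod
  simp [hbv] at hzero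
  exact hp0 hzero

/-- A holomorphic function `h` on the unit disc with `‖h' z‖ ≤ ‖h' 0‖ / (1 - ‖z‖ ^ 2)` covers a
disc of radius `‖h' 0‖ / 8` around `h 0`. -/
theorem ball_subset_image_of_norm_deriv_mul_le {h : ℂ → ℂ} (hh : DifferentiableOn ℂ h (ball 0 1))
    (hle : ∀ z ∈ ball (0 : ℂ) 1, ‖deriv h z‖ * (1 - ‖z‖ ^ 2) ≤ ‖deriv h 0‖)
    (h0 : deriv h 0 ≠ 0) : ball (h 0) (‖deriv h 0‖ / 8) ⊆ h '' ball 0 1 := by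
  set p := deriv h with hp_def
  set M := ‖p 0‖ with hM
  have hMpos : 0 < M := norm_pos_iff.2 h0
  have hpd : DifferentiableOn ℂ p (ball 0 1) := hh.deriv isOpen_ball
  have hp0 : DifferentiableAt ℂ p 0 := hpd.differentiableAt (ball_mem_nhds _ one_pos)
  have hp' : deriv p 0 = 0 := deriv_eq_zero_of_norm_mul_le hp0 h0 hle
  set ρ : ℝ := Real.sqrt (3 / 5) with hρ
  have hρ2 : ρ ^ 2 = 3 / 5 := Real.sq_sqrt (by norm_num)
  have hρ0 : 0 < ρ := Real.sqrt_pos.2 (by norm_num)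
  have hρ1 : ρ < 1 := by nlinarith
  have hρ25 : 2 / 5 < ρ := by nlinarith
  have hschwarz : ∀ z ∈ ball (0 : ℂ) ρ, ‖p z - p 0‖ ≤ 35 / 6 * M * ‖z‖ ^ 2 := by
    intro z hz
    have hmaps : MapsTo p (ball 0 ρ) (closedBall (p 0) (7 / 2 * M)) := by
      intro w hw
      have hw' : ‖w‖ < ρ := by simpa using hw
      have h1 := hle w (by simpa using hw'.trans hρ1)
      have h2 : 2 / 5 ≤ 1 - ‖w‖ ^ 2 := by nlinarith [norm_nonneg w]
      have h3 : ‖p w‖ ≤ 5 / 2 * M := by nlinarith [norm_nonneg (p w)]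
      rw [mem_closedBall, dist_eq_norm]
      linarith [norm_sub_le (p w) (p 0)]
    have hlittle : (p · - p 0) =o[𝓝 0] fun w : ℂ => ‖w - 0‖ ^ 1 := by
      have := hp0.hasDerivAt.isLittleO
      rw [hp'] at this
      simpa using this.norm_right
    have h1 := Complex.dist_le_mul_div_pow_of_mapsTo_ball_of_isLittleO
      (hpd.mono (ball_subset_ball hρ1.le)) hmaps hlittle hz
    rw [dist_eq_norm, dist_zero_right, div_pow, hρ2] at h1
    linarith
  have hcubic : ∀ z ∈ sphere (0 : ℂ) (2 / 5), 11 / 40 * M ≤ ‖h z - h 0‖ := by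
    intro z hz
    have hz' : ‖z‖ = 2 / 5 := by simpa using hz
    have hmem : ∀ t ∈ Icc (0 : ℝ) 1, ‖(t : ℂ) * z‖ ≤ 2 / 5 := fun t ht => by
      rw [norm_mul, hz', Complex.norm_real, Real.norm_of_nonneg ht.1]
      linarith [ht.2]
    have hderiv : ∀ t ∈ Icc (0 : ℝ) 1,
        HasDerivAt (fun t : ℝ => h (t * z) - h 0 - t * z * p 0) ((p (t * z) - p 0) * z) t := by
      intro t ht
      have h1 : HasDerivAt (fun x : ℝ => (x : ℂ) * z) z t := by
        simpa using (Complex.ofRealCLM.hasDerivAt (x := t)).mul_const z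
      have h2 : HasDerivAt h (p (t * z)) ((fun x : ℝ => (x : ℂ) * z) t) :=
        (hh.differentiableAt (isOpen_ball.mem_nhds (by
          rw [mem_ball_zero_iff]; linarith [hmem t ht]))).hasDerivAt
      convert! ((h2.comp t h1).sub_const (h 0)).sub (h1.mul_const (p 0)) using 1
      ring
    have hbound : ‖h ((1 : ℝ) * z) - h 0 - (1 : ℝ) * z * p 0‖ ≤
        35 / 18 * M * (2 / 5) ^ 3 * 1 ^ 3 := by
      refine image_norm_le_of_norm_deriv_right_le_deriv_boundary
        (f := fun t : ℝ => h (t * z) - h 0 - t * z * p 0) (a := 0) (b := 1)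
        (f' := fun t : ℝ => (p (t * z) - p 0) * z)
        (B := fun t => 35 / 18 * M * (2 / 5) ^ 3 * t ^ 3)
        (B' := fun t => 35 / 6 * M * (2 / 5) ^ 3 * t ^ 2)
        (fun t ht => (hderiv t ht).continuousAt.continuousWithinAt)
        (fun t ht => (hderiv t (Ico_subset_Icc_self ht)).hasDerivWithinAt) (by simp)
        (fun t => ?_) (fun t ht => ?_) ⟨zero_le_one, le_rfl⟩
      · convert! (hasDerivAt_pow 3 t).const_mul (35 / 18 * M * (2 / 5) ^ 3) using 1
        norm_num
        ring
      · have h1 := hschwarz (t * z) (by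
          rw [mem_ball_zero_iff]; linarith [hmem t (Ico_subset_Icc_self ht)])
        rw [norm_mul, hz']
        rw [norm_mul, hz', Complex.norm_real, Real.norm_of_nonneg ht.1] at h1
        linarith
    have h2 : ‖z * p 0‖ = 2 / 5 * M := by rw [norm_mul, hz']
    have h3 : ‖z * p 0‖ ≤ ‖h z - h 0‖ + ‖h z - h 0 - z * p 0‖ := by
      have := norm_sub_le (h z - h 0) (h z - h 0 - z * p 0)
      rwa [show h z - h 0 - (h z - h 0 - z * p 0) = z * p 0 by ring] at this
    simp only [Complex.ofReal_one, one_mul] at hbound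
    linarith
  have hfreq : ∃ᶠ z in 𝓝 (0 : ℂ), h z ≠ h 0 := by
    intro hev
    have hev' : h =ᶠ[𝓝 0] fun _ => h 0 := hev.mono fun z hz => not_not.1 hz
    exact h0 (by simpa using hev'.deriv_eq)
  have hsub : closedBall (0 : ℂ) (2 / 5) ⊆ ball 0 1 := closedBall_subset_ball (by norm_num)
  have hdc : DiffContOnCl ℂ h (ball 0 (2 / 5)) :=
    (hh.mono (by rw [closure_ball _ (by norm_num)]; exact hsub)).diffContOnCl
  refine ((ball_subset_ball ?_).trans
    (hdc.ball_subset_image_closedBall (by norm_num) hcubic hfreq)).trans (image_mono hsub)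
  linarith

theorem Complex.one_sub_norm_sq_mobius {a w : ℂ} (h : 1 + starRingEnd ℂ a * w ≠ 0) :
    1 - ‖(w + a) / (1 + starRingEnd ℂ a * w)‖ ^ 2 =
      (1 - ‖a‖ ^ 2) * (1 - ‖w‖ ^ 2) / ‖1 + starRingEnd ℂ a * w‖ ^ 2 := by
  have h' : ‖1 + starRingEnd ℂ a * w‖ ^ 2 ≠ 0 := by positivity
  rw [norm_div, div_pow, eq_div_iff h', sub_mul, div_mul_cancel₀ _ h', one_mul]
  simp only [← Complex.normSq_eq_norm_sq, Complex.normSq_apply, Complex.add_re, Complex.add_im,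
    Complex.mul_re, Complex.mul_im, Complex.conj_re, Complex.conj_im, Complex.one_re,
    Complex.one_im]
  ring

/-- A version of **Bloch's theorem**: a holomorphic function on the unit disc with `8 s < ‖F' 0‖`
covers a closed disc of radius `s` centred at one of its values. -/
theorem exists_closedBall_subset_image_ball {F : ℂ → ℂ} (hF : DifferentiableOn ℂ F (ball 0 1))
    {s : ℝ} (hs : 0 ≤ s) (hlt : 8 * s < ‖deriv F 0‖) :
    ∃ z ∈ ball (0 : ℂ) 1, closedBall (F z) s ⊆ F '' ball 0 1 := by
  obtain ⟨t, ht0, ht1, ht⟩ : ∃ t : ℝ, 0 < t ∧ t < 1 ∧ 8 * s < t * ‖deriv F 0‖ := by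
    have hD : 0 < ‖deriv F 0‖ := by linarith
    obtain ⟨t, h1, h2⟩ := exists_between ((div_lt_one hD).2 hlt)
    exact ⟨t, (by positivity : 0 ≤ 8 * s / ‖deriv F 0‖).trans_lt h1, h2, (div_lt_iff₀ hD).1 h1⟩
  have hscale : ∀ z ∈ closedBall (0 : ℂ) 1, (t : ℂ) * z ∈ ball (0 : ℂ) 1 := fun z hz => by
    rw [mem_ball_zero_iff, norm_mul, Complex.norm_real, Real.norm_of_nonneg ht0.le]
    have : ‖z‖ ≤ 1 := by simpa using hz
    nlinarith [norm_nonneg z]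
  have hF' : ContinuousOn (deriv F) (ball 0 1) := (hF.deriv isOpen_ball).continuousOn
  set u : ℂ → ℝ := fun z => (1 - ‖z‖ ^ 2) * (t * ‖deriv F (t * z)‖) with hu
  have hucont : ContinuousOn u (closedBall 0 1) := by
    have : ContinuousOn (fun z : ℂ => deriv F (t * z)) (closedBall 0 1) :=
      hF'.comp (by fun_prop) hscale
    fun_prop
  obtain ⟨a, ha, hmax⟩ := (isCompact_closedBall (0 : ℂ) 1).exists_isMaxOn
    ⟨0, mem_closedBall_self zero_le_one⟩ hucont
  have hua : 8 * s < u a := by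
    refine ht.trans_le ?_
    simpa [hu] using hmax (mem_closedBall_self zero_le_one : (0 : ℂ) ∈ closedBall 0 1)
  have ha1 : ‖a‖ < 1 := by
    refine lt_of_le_of_ne (by simpa using ha) fun h => ?_
    have : u a = 0 := by simp [hu, h]
    linarith
  have hden : ∀ w ∈ ball (0 : ℂ) 1, 1 + starRingEnd ℂ a * w ≠ 0 := by
    intro w hw h0
    have hw' : ‖w‖ < 1 := by simpa using hw
    have h1 : ‖starRingEnd ℂ a * w‖ = 1 := by
      rw [eq_neg_of_add_eq_zero_right h0, norm_neg, norm_one]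
    rw [norm_mul, RCLike.norm_conj] at h1
    nlinarith [norm_nonneg a, norm_nonneg w]
  set ψ : ℂ → ℂ := fun w => (w + a) / (1 + starRingEnd ℂ a * w) with hψ
  have hψball : ∀ w ∈ ball (0 : ℂ) 1, ψ w ∈ ball (0 : ℂ) 1 := by
    intro w hw
    have hw' : ‖w‖ < 1 := by simpa using hw
    have h1 := Complex.one_sub_norm_sq_mobius (hden w hw)
    have h2 : 0 < (1 - ‖a‖ ^ 2) * (1 - ‖w‖ ^ 2) / ‖1 + starRingEnd ℂ a * w‖ ^ 2 := by
      have := norm_pos_iff.2 (hden w hw)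
      have : 0 < 1 - ‖a‖ ^ 2 := by nlinarith [norm_nonneg a]
      have : 0 < 1 - ‖w‖ ^ 2 := by nlinarith [norm_nonneg w]
      positivity
    rw [← h1] at h2
    rw [mem_ball_zero_iff]
    by_contra! hge
    have : 1 ≤ ‖ψ w‖ ^ 2 := one_le_pow₀ hge
    simp only [hψ] at this
    linarith
  have hψderiv : ∀ w ∈ ball (0 : ℂ) 1, HasDerivAt ψ
      ((1 - ‖a‖ ^ 2 : ℝ) / (1 + starRingEnd ℂ a * w) ^ 2) w := by
    intro w hw
    have h1 : HasDerivAt (fun w : ℂ => w + a) 1 w := (hasDerivAt_id w).add_const a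
    have h2 : HasDerivAt (fun w : ℂ => 1 + starRingEnd ℂ a * w) (starRingEnd ℂ a) w := by
      simpa using ((hasDerivAt_id w).const_mul (starRingEnd ℂ a)).const_add 1
    refine (h1.div h2 (hden w hw)).congr_deriv ?_
    have : ((‖a‖ : ℂ)) ^ 2 = starRingEnd ℂ a * a := by
      rw [mul_comm, Complex.mul_conj, Complex.normSq_eq_norm_sq]; simp
    push_cast
    rw [this]
    congr 1
    ring
  set h : ℂ → ℂ := fun w => F (t * ψ w) with hh
  have hhderiv : ∀ w ∈ ball (0 : ℂ) 1, HasDerivAt h (deriv F (t * ψ w) *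
      (t * ((1 - ‖a‖ ^ 2 : ℝ) / (1 + starRingEnd ℂ a * w) ^ 2))) w := by
    intro w hw
    have h1 := (hF.differentiableAt (isOpen_ball.mem_nhds
      (hscale _ (ball_subset_closedBall (hψball w hw))))).hasDerivAt
    exact HasDerivAt.comp w h1 ((hψderiv w hw).const_mul (t : ℂ))
  have hapos : 0 < 1 - ‖a‖ ^ 2 := by nlinarith [norm_nonneg a]
  have hnorm : ∀ w ∈ ball (0 : ℂ) 1, ‖deriv h w‖ * (1 - ‖w‖ ^ 2) = u (ψ w) := by
    intro w hw
    rw [(hhderiv w hw).deriv, hu]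
    simp only [hψ]
    rw [Complex.one_sub_norm_sq_mobius (hden w hw)]
    simp only [norm_mul, norm_div, norm_pow, Complex.norm_real, Real.norm_of_nonneg ht0.le,
      Real.norm_of_nonneg hapos.le]
    ring
  have h0 : ‖deriv h 0‖ = u a := by simpa [hψ] using hnorm 0 (mem_ball_self one_pos)
  have hcover := ball_subset_image_of_norm_deriv_mul_le (h := h)
    (fun w hw => (hhderiv w hw).differentiableAt.differentiableWithinAt)
    (fun w hw => by
      rw [hnorm w hw, h0]
      exact hmax (ball_subset_closedBall (hψball w hw)))
    (norm_pos_iff.1 (by rw [h0]; linarith))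
  refine ⟨t * a, hscale a ha, fun y hy => ?_⟩
  have hh0 : h 0 = F (t * a) := by simp [hh, hψ]
  rw [hh0, h0] at hcover
  obtain ⟨w, hw, rfl⟩ := hcover (closedBall_subset_ball (by linarith) hy)
  exact ⟨t * ψ w, hscale _ (ball_subset_closedBall (hψball w hw)), rfl⟩

/-- A nonvanishing holomorphic function on a disc has a holomorphic logarithm. -/
theorem exists_exp_eq_of_ne_zero_on_ball {g : ℂ → ℂ} {c : ℂ} {r : ℝ} (hr : 0 < r)
    (hg : DifferentiableOn ℂ g (ball c r)) (h0 : ∀ z ∈ ball c r, g z ≠ 0) :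
    ∃ F : ℂ → ℂ, DifferentiableOn ℂ F (ball c r) ∧ ∀ z ∈ ball c r, Complex.exp (F z) = g z := by
  have hc : c ∈ ball c r := mem_ball_self hr
  obtain ⟨F, hFc, hF⟩ := (((hg.deriv isOpen_ball).div hg h0).isExactOn_ball).with_val_at c
    (Complex.log (g c))
  have hderiv : ∀ z ∈ ball c r, HasDerivAt (fun z => g z * Complex.exp (-F z)) 0 z := by
    intro z hz
    have h1 := (hg.differentiableAt (isOpen_ball.mem_nhds hz)).hasDerivAt
    refine (h1.mul (hF z hz).neg.cexp).congr_deriv ?_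
    have := h0 z hz
    simp only [Pi.div_apply, Pi.neg_apply]
    field_simp
    ring
  refine ⟨F, fun z hz => (hF z hz).differentiableAt.differentiableWithinAt, fun z hz => ?_⟩
  have hconst := isOpen_ball.is_const_of_deriv_eq_zero (convex_ball c r).isPreconnected
    (fun w hw => (hderiv w hw).differentiableAt.differentiableWithinAt)
    (fun w hw => (hderiv w hw).deriv) hz hc
  simp only [hFc, Complex.exp_neg, Complex.exp_log (h0 c hc), mul_inv_cancel₀ (h0 c hc)] at hconst
  exact ((mul_inv_eq_one₀ (Complex.exp_ne_zero _)).1 hconst).symm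

/-- An injective nonvanishing holomorphic function `g` on the unit disc satisfies
`‖g' 0‖ ≤ 8 π ‖g 0‖`. -/
theorem norm_deriv_le_of_injOn_ball_of_ne_zero {g : ℂ → ℂ} (hg : DifferentiableOn ℂ g (ball 0 1))
    (hinj : InjOn g (ball 0 1)) (h0 : ∀ z ∈ ball (0 : ℂ) 1, g z ≠ 0) :
    ‖deriv g 0‖ ≤ 8 * Real.pi * ‖g 0‖ := by
  obtain ⟨F, hF, hFg⟩ := exists_exp_eq_of_ne_zero_on_ball one_pos hg h0
  have hmem : (0 : ℂ) ∈ ball (0 : ℂ) 1 := mem_ball_self one_pos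
  have hderiv : deriv g 0 = g 0 * deriv F 0 := by
    have hev : g =ᶠ[𝓝 0] fun z => Complex.exp (F z) :=
      Filter.eventuallyEq_of_mem (isOpen_ball.mem_nhds hmem) fun z hz => (hFg z hz).symm
    rw [hev.deriv_eq, ← hFg 0 hmem]
    exact (hF.differentiableAt (isOpen_ball.mem_nhds hmem)).hasDerivAt.cexp.deriv
  rw [hderiv, norm_mul, mul_comm]
  refine mul_le_mul_of_nonneg_right ?_ (norm_nonneg _)
  by_contra! hlt
  obtain ⟨z, -, hz⟩ := exists_closedBall_subset_image_ball hF Real.pi_pos.le hlt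
  have hpi : ‖(Real.pi : ℂ) * Complex.I‖ = Real.pi := by
    simp [Real.pi_pos.le]
  obtain ⟨w₁, hw₁, h₁⟩ := hz (show F z + Real.pi * Complex.I ∈ closedBall (F z) Real.pi by
    rw [mem_closedBall, dist_eq_norm, add_sub_cancel_left, hpi])
  obtain ⟨w₂, hw₂, h₂⟩ := hz (show F z - Real.pi * Complex.I ∈ closedBall (F z) Real.pi by
    rw [mem_closedBall, dist_eq_norm, sub_sub_cancel_left, norm_neg, hpi])
  have hw : w₁ = w₂ := hinj hw₁ hw₂ <| by
    rw [← hFg w₁ hw₁, ← hFg w₂ hw₂, Complex.exp_eq_exp_iff_exists_int]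
    exact ⟨1, by rw [h₁, h₂]; push_cast; ring⟩
  rw [hw, h₂] at h₁
  have h3 : (Real.pi : ℂ) * Complex.I = 0 := by linear_combination -h₁ / 2
  rw [h3, norm_zero] at hpi
  exact Real.pi_ne_zero hpi.symm

/-- An injective nonvanishing holomorphic function `G` on the half-plane `L < re ζ` satisfies
`(re ζ - L) ‖G' ζ‖ ≤ 4 π ‖G ζ‖`. -/
theorem norm_deriv_le_of_injOn_halfPlane_of_ne_zero {G : ℂ → ℂ} {L : ℝ} {ζ₀ : ℂ}
    (hG : DifferentiableOn ℂ G {ζ | L < ζ.re}) (hinj : InjOn G {ζ | L < ζ.re})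
    (h0 : ∀ ζ, L < ζ.re → G ζ ≠ 0) (hζ₀ : L < ζ₀.re) :
    (ζ₀.re - L) * ‖deriv G ζ₀‖ ≤ 4 * Real.pi * ‖G ζ₀‖ := by
  set r := ζ₀.re - L with hr
  have hr0 : 0 < r := sub_pos.2 hζ₀
  have hopen : IsOpen {ζ : ℂ | L < ζ.re} := isOpen_lt continuous_const Complex.continuous_re
  have hne : ∀ w ∈ ball (0 : ℂ) 1, 1 - w ≠ 0 := by
    intro w hw h
    rw [← sub_eq_zero.1 h] at hw
    simp at hw
  set φ : ℂ → ℂ := fun w => ζ₀ + 2 * r * w / (1 - w) with hφ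
  have hφmem : ∀ w ∈ ball (0 : ℂ) 1, L < (φ w).re := by
    intro w hw
    have hw' : ‖w‖ < 1 := by simpa using hw
    have hpos : 0 < Complex.normSq (1 - w) := Complex.normSq_pos.2 (hne w hw)
    have hsq : w.re ^ 2 + w.im ^ 2 < 1 := by
      have : Complex.normSq w < 1 := by
        rw [Complex.normSq_eq_norm_sq]; nlinarith [norm_nonneg w]
      rw [Complex.normSq_apply] at this
      linarith
    have hre : (φ w).re - L = r * (1 - (w.re ^ 2 + w.im ^ 2)) / Complex.normSq (1 - w) := by
      have h1 : (φ w).re = ζ₀.re + (2 * r * w / (1 - w)).re := rfl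
      rw [h1, Complex.div_re, eq_div_iff hpos.ne', add_sub_right_comm, ← hr, add_mul, add_mul,
        div_mul_cancel₀ _ hpos.ne', div_mul_cancel₀ _ hpos.ne', Complex.normSq_apply]
      simp
      ring
    have : 0 < (φ w).re - L := by
      rw [hre]
      exact div_pos (mul_pos hr0 (by linarith)) hpos
    linarith
  have hφderiv : ∀ w ∈ ball (0 : ℂ) 1, HasDerivAt φ (2 * r / (1 - w) ^ 2) w := by
    intro w hw
    have h1 : HasDerivAt (fun w : ℂ => 2 * (r : ℂ) * w) (2 * r) w := by
      simpa using (hasDerivAt_id w).const_mul (2 * (r : ℂ))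
    have h2 : HasDerivAt (fun w : ℂ => 1 - w) (-1) w := (hasDerivAt_id w).const_sub 1
    refine ((h1.div h2 (hne w hw)).const_add ζ₀).congr_deriv ?_
    congr 1
    ring
  have hφinj : InjOn φ (ball 0 1) := by
    intro w hw w' hw' h
    have h1 := add_left_cancel h
    rw [div_eq_div_iff (hne w hw) (hne w' hw')] at h1
    have h2 : (2 * (r : ℂ)) * (w - w') = 0 := by linear_combination h1
    have h3 : (2 * (r : ℂ)) ≠ 0 := by
      simpa using hr0.ne'
    exact sub_eq_zero.1 ((mul_eq_zero.1 h2).resolve_left h3)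
  have hφ0 : φ 0 = ζ₀ := by simp [hφ]
  have hmem : (0 : ℂ) ∈ ball (0 : ℂ) 1 := mem_ball_self one_pos
  have hcomp := norm_deriv_le_of_injOn_ball_of_ne_zero
    (hG.comp (fun w hw => (hφderiv w hw).differentiableAt.differentiableWithinAt) hφmem)
    (hinj.comp hφinj hφmem) (fun w hw => h0 _ (hφmem w hw))
  have hGd : HasDerivAt G (deriv G ζ₀) (φ 0) := by
    rw [hφ0]
    exact (hG.differentiableAt (hopen.mem_nhds hζ₀)).hasDerivAt
  rw [(hGd.comp 0 (hφderiv 0 hmem)).deriv, Function.comp_apply, hφ0] at hcomp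
  simp only [sub_zero, one_pow, div_one, norm_mul, Complex.norm_real, Real.norm_of_nonneg hr0.le,
    Complex.norm_ofNat] at hcomp
  linarith

theorem eremenko_lyubich_logderiv_lower_bound
    (f : ℂ → ℂ) (hf : ELClass f) :
    ∃ R : ℝ, 0 < R ∧ ∀ z : ℂ, f z ≠ 0 →
      (1 / (4 * Real.pi)) * Real.log (‖f z‖ / R) ≤ ‖z * deriv f z / f z‖ := by
  obtain ⟨⟨hd, htr⟩, hb⟩ := hf
  obtain ⟨B, hB⟩ := hb.exists_norm_le
  set R := max (max B ‖f 0‖) 1 with hR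
  have hR0 : 0 < R := one_pos.trans_le (le_max_right _ _)
  have hBR : B ≤ R := (le_max_left _ _).trans (le_max_left _ _)
  have hfR : ‖f 0‖ ≤ R := (le_max_right _ _).trans (le_max_left _ _)
  have hcrit : ∀ z, R < ‖f z‖ → deriv f z ≠ 0 := fun z hz h =>
    hz.not_ge ((hB _ (Or.inl ⟨z, h, rfl⟩)).trans hBR)
  have hasym : ∀ a ∈ asymptoticValues f, ‖a‖ ≤ R := fun a ha => (hB a (Or.inr ha)).trans hBR
  refine ⟨R, hR0, fun z₀ hz₀ => ?_⟩
  have hpos : 0 < ‖f z₀‖ := norm_pos_iff.2 hz₀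
  rcases le_or_gt ‖f z₀‖ R with hle | hlt
  · exact (mul_nonpos_of_nonneg_of_nonpos (by positivity)
      (Real.log_nonpos (by positivity) ((div_le_one hR0).2 hle))).trans (norm_nonneg _)
  set ζ₀ := Complex.log (f z₀) with hζ₀_def
  have hexp : f z₀ = Complex.exp ζ₀ := (Complex.exp_log hz₀).symm
  have hre : ζ₀.re = Real.log ‖f z₀‖ := Complex.log_re _
  have hζ₀ : Real.log R < ζ₀.re := hre ▸ Real.log_lt_log hR0 hlt
  obtain ⟨G, hGz, hG, hfG⟩ := exists_exp_lift hd hR0 hcrit hasym hζ₀ hexp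
  have hlarge : ∀ ζ, Real.log R < ζ.re → R < ‖f (G ζ)‖ := fun ζ hζ => by
    rw [hfG ζ hζ, Complex.norm_exp]
    exact (Real.log_lt_iff_lt_exp hR0).1 hζ
  have hinj := injOn_exp_lift hd htr hG hfG fun ζ hζ => hcrit _ (hlarge ζ hζ)
  have hkey := norm_deriv_le_of_injOn_halfPlane_of_ne_zero hG hinj
    (fun ζ hζ h => (hlarge ζ hζ).not_ge (by rwa [h])) hζ₀
  rw [hGz] at hkey
  have hopen : IsOpen {ζ : ℂ | Real.log R < ζ.re} :=
    isOpen_lt continuous_const Complex.continuous_re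
  have hchain : deriv f z₀ * deriv G ζ₀ = f z₀ := by
    have h1 : HasDerivAt G (deriv G ζ₀) ζ₀ :=
      (hG.differentiableAt (hopen.mem_nhds hζ₀)).hasDerivAt
    have h2 : HasDerivAt f (deriv f z₀) (G ζ₀) := hGz ▸ (hd (G ζ₀)).hasDerivAt
    have h3 := (h2.comp ζ₀ h1).congr_of_eventuallyEq
      (f₁ := Complex.exp)
      (Filter.eventuallyEq_of_mem (hopen.mem_nhds hζ₀) fun ζ hζ => (hfG ζ hζ).symm)
    rw [hexp]
    exact h3.unique (Complex.hasDerivAt_exp ζ₀)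
  have hGne : 0 < ‖deriv G ζ₀‖ := norm_pos_iff.2 fun h => hz₀ (by rw [← hchain, h, mul_zero])
  have hnorm : ‖deriv f z₀‖ * ‖deriv G ζ₀‖ = ‖f z₀‖ := by rw [← norm_mul, hchain]
  have hdne : 0 < ‖deriv f z₀‖ := norm_pos_iff.2 (hcrit z₀ hlt)
  rw [Real.log_div hpos.ne' hR0.ne', ← hre, norm_div, norm_mul, ← hnorm, mul_comm ‖z₀‖,
    mul_div_mul_left _ _ hdne.ne', one_div_mul_eq_div, div_le_div_iff₀ (by positivity) hGne]
  linarith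
end
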